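/- arXiv:1806.06903 — 2 statements merged into one kernel-verified Lean document; each statement's English description precedes it below -/
import Mathlib

section
/- Suppose 0 < 1/n ≪ c ≪ β ≪ 1/ℓ < 1, n is divisible by 3, and G is an oriented graph on n vertices with δ⁰(G) ≥ (1/2 - c)n. If the vertex set V(G) is (H(G), β, ℓ)-closed, where H(G) is the 3-uniform hypergraph whose edges are the cyclic triangles of G, then G has a cyclic triangle factor. -/
open Finset
open scoped Classical

/-- An oriented graph: no loops and no pair of antiparallel edges. -/
def IsOriented {n : ℕ} (G : Fin n → Fin n → Prop) : Prop :=
  (∀ v, ¬ G v v) ∧ ∀ u v : Fin n, G u v → ¬ G v u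

/-- `d⁺(v, A)`: number of out-neighbors of `v` in `A`. -/
noncomputable def outDegOn {n : ℕ} (G : Fin n → Fin n → Prop) (v : Fin n)
    (A : Finset (Fin n)) : ℕ :=
  (A.filter fun u => G v u).card

/-- `d⁻(v, A)`: number of in-neighbors of `v` in `A`. -/
noncomputable def inDegOn {n : ℕ} (G : Fin n → Fin n → Prop) (v : Fin n)
    (A : Finset (Fin n)) : ℕ :=
  (A.filter fun u => G u v).card

/-- outdegree `d⁺(v)`. -/
noncomputable def outDeg {n : ℕ} (G : Fin n → Fin n → Prop) (v : Fin n) : ℕ :=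
  outDegOn G v univ

/-- indegree `d⁻(v)`. -/
noncomputable def inDeg {n : ℕ} (G : Fin n → Fin n → Prop) (v : Fin n) : ℕ :=
  inDegOn G v univ

/-- The minimum semidegree condition `δ⁰(G) ≥ b`. -/
def MinSemidegreeGE {n : ℕ} (G : Fin n → Fin n → Prop) (b : ℝ) : Prop :=
  ∀ v : Fin n, b ≤ (outDeg G v : ℝ) ∧ b ≤ (inDeg G v : ℝ)

/-- `e⁺(A, B)`: number of edges directed from `A` to `B`. -/
noncomputable def eOut {n : ℕ} (G : Fin n → Fin n → Prop) (A B : Finset (Fin n)) : ℕ :=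
  ∑ a ∈ A, outDegOn G a B

/-- `s` is the vertex set of a cyclic triangle. -/
def IsCycTri {n : ℕ} (G : Fin n → Fin n → Prop) (s : Finset (Fin n)) : Prop :=
  ∃ a b c : Fin n, G a b ∧ G b c ∧ G c a ∧ s = {a, b, c}

/-- `s` is the vertex set of a transitive triangle. -/
def IsTrnTri {n : ℕ} (G : Fin n → Fin n → Prop) (s : Finset (Fin n)) : Prop :=
  ∃ a b c : Fin n, G a b ∧ G b c ∧ G a c ∧ s = {a, b, c}

/-- `cyc(A)`: number of cyclic triangles with all vertices in `A`. -/
noncomputable def cycIn {n : ℕ} (G : Fin n → Fin n → Prop) (A : Finset (Fin n)) : ℕ :=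
  ((A.powersetCard 3).filter fun s => IsCycTri G s).card

/-- `trn(A)`: number of transitive triangles with all vertices in `A`. -/
noncomputable def trnIn {n : ℕ} (G : Fin n → Fin n → Prop) (A : Finset (Fin n)) : ℕ :=
  ((A.powersetCard 3).filter fun s => IsTrnTri G s).card

/-- `cyc(A, B, C)`: number of cyclic triangles with one vertex in each of `A`, `B`, `C`
(in the sense of some labeling of its vertex set). -/
noncomputable def cyc3 {n : ℕ} (G : Fin n → Fin n → Prop) (A B C : Finset (Fin n)) : ℕ :=
  (((univ : Finset (Fin n)).powersetCard 3).filter fun s =>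
    IsCycTri G s ∧ ∃ x ∈ A, ∃ y ∈ B, ∃ z ∈ C, s = ({x, y, z} : Finset (Fin n))).card

/-- A cyclic triangle tiling: a collection of vertex-disjoint cyclic triangles. -/
def IsCycTiling {n : ℕ} (G : Fin n → Fin n → Prop) (C : Finset (Finset (Fin n))) : Prop :=
  (∀ s ∈ C, IsCycTri G s) ∧ ∀ s ∈ C, ∀ t ∈ C, s ≠ t → Disjoint s t

/-- A cyclic triangle factor: a tiling covering every vertex. -/
def IsCycFactor {n : ℕ} (G : Fin n → Fin n → Prop) (C : Finset (Finset (Fin n))) : Prop :=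
  IsCycTiling G C ∧ C.biUnion id = univ

/-- `W` can be perfectly covered by vertex-disjoint cyclic triangles
(i.e. `H(G)[W]` has a perfect matching). -/
def HasCycPM {n : ℕ} (G : Fin n → Fin n → Prop) (W : Finset (Fin n)) : Prop :=
  ∃ C : Finset (Finset (Fin n)), IsCycTiling G C ∧ C.biUnion id = W

/-- The number of `(H(G), x, y)`-linking `(3ℓ-1)`-sets. -/
noncomputable def linkCount {n : ℕ} (G : Fin n → Fin n → Prop) (ℓ : ℕ) (x y : Fin n) : ℕ :=
  (((univ : Finset (Fin n)).powersetCard (3 * ℓ - 1)).filter fun S =>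
    x ∉ S ∧ y ∉ S ∧ HasCycPM G (insert x S) ∧ HasCycPM G (insert y S)).card

section Matchings

variable {n : ℕ} {G : Fin n → Fin n → Prop}

lemma IsCycTri.hasCycPM {s : Finset (Fin n)} (h : IsCycTri G s) : HasCycPM G s := by
  refine ⟨{s}, ⟨by simpa using h, ?_⟩, by simp⟩
  intro a ha b hb hab
  rw [Finset.mem_singleton] at ha hb
  exact absurd (ha.trans hb.symm) hab

lemma hasCycPM_empty : HasCycPM G ∅ :=
  ⟨∅, ⟨by simp, by simp⟩, by simp⟩

lemma HasCycPM.union {W W' : Finset (Fin n)} (h : HasCycPM G W) (h' : HasCycPM G W')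
    (hd : Disjoint W W') : HasCycPM G (W ∪ W') := by
  obtain ⟨C, ⟨hC, hCd⟩, rfl⟩ := h
  obtain ⟨C', ⟨hC', hCd'⟩, rfl⟩ := h'
  have cross : ∀ s ∈ C, ∀ t ∈ C', Disjoint s t := fun s hs t ht =>
    hd.mono (Finset.subset_biUnion_of_mem id hs) (Finset.subset_biUnion_of_mem id ht)
  refine ⟨C ∪ C', ⟨?_, ?_⟩, Finset.union_biUnion⟩
  · intro s hs
    rcases Finset.mem_union.1 hs with hs | hs
    exacts [hC s hs, hC' s hs]
  · intro s hs t ht hst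
    rcases Finset.mem_union.1 hs with hs | hs <;> rcases Finset.mem_union.1 ht with ht | ht
    exacts [hCd s hs t ht hst, cross s hs t ht, (cross t ht s hs).symm, hCd' s hs t ht hst]

lemma hasCycPM_biUnion {ι : Type*} {I : Finset ι} {f : ι → Finset (Fin n)}
    (hd : (I : Set ι).PairwiseDisjoint f) (h : ∀ i ∈ I, HasCycPM G (f i)) :
    HasCycPM G (I.biUnion f) := by
  classical
  induction I using Finset.induction_on with
  | empty => simpa using hasCycPM_empty
  | insert i I hi ih =>
    rw [Finset.biUnion_insert]
    rw [Finset.coe_insert] at hd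
    refine (h i (Finset.mem_insert_self i I)).union
      (ih (hd.subset (Set.subset_insert _ _)) fun j hj => h j (Finset.mem_insert_of_mem hj)) ?_
    rw [Finset.disjoint_biUnion_right]
    intro j hj
    exact hd (Set.mem_insert _ _) (Set.mem_insert_of_mem _ hj) (fun hij => hi (hij ▸ hj))

/-- A leftover set `R` of `3 * r` vertices can be absorbed by a family `I` of disjoint tiled
sets, provided every triple of `R` can be absorbed by at least `r` members of `I`. -/
lemma hasCycPM_union_of_absorbing (r : ℕ) : ∀ (R : Finset (Fin n)) (I : Finset (Finset (Fin n))),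
    R.card = 3 * r → (∀ B ∈ I, HasCycPM G B) →
    ((I : Set (Finset (Fin n))).PairwiseDisjoint id) → (∀ B ∈ I, Disjoint R B) →
    (∀ t ⊆ R, t.card = 3 → r ≤ (I.filter fun B => HasCycPM G (B ∪ t)).card) →
    HasCycPM G (R ∪ I.biUnion id) := by
  induction r with
  | zero =>
    intro R I hR hI hd _ _
    obtain rfl : R = ∅ := Finset.card_eq_zero.1 (by simpa using hR)
    rw [Finset.empty_union]
    exact hasCycPM_biUnion hd hI
  | succ r ih =>
    intro R I hR hI hd hRI habs
    obtain ⟨t, htR, ht⟩ := Finset.exists_subset_card_eq (show 3 ≤ R.card by omega)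
    obtain ⟨B, hB⟩ := Finset.card_pos.1 (lt_of_lt_of_le (Nat.succ_pos r) (habs t htR ht))
    obtain ⟨hBI, hBt⟩ := Finset.mem_filter.1 hB
    have hsub : I.erase B ⊆ I := Finset.erase_subset _ _
    have key : HasCycPM G ((R \ t) ∪ (I.erase B).biUnion id) := by
      refine ih _ _ ?_ (fun D hD => hI D (hsub hD)) (hd.subset (by exact_mod_cast hsub))
        (fun D hD => (hRI D (hsub hD)).mono_left Finset.sdiff_subset) ?_
      · rw [Finset.card_sdiff_of_subset htR]; omega
      · intro s hs hs3
        have h1 := habs s (hs.trans Finset.sdiff_subset) hs3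
        rw [Finset.filter_erase]
        have := Finset.pred_card_le_card_erase
          (s := I.filter fun B => HasCycPM G (B ∪ s)) (a := B)
        omega
    have hdisj : Disjoint (B ∪ t) ((R \ t) ∪ (I.erase B).biUnion id) := by
      rw [Finset.disjoint_union_left, Finset.disjoint_union_right, Finset.disjoint_union_right,
        Finset.disjoint_biUnion_right, Finset.disjoint_biUnion_right]
      refine ⟨⟨((hRI B hBI).mono_left Finset.sdiff_subset).symm, fun D hD => ?_⟩,
        Finset.disjoint_sdiff, fun D hD => (hRI D (hsub hD)).mono_left htR⟩
      exact hd hBI (hsub hD) (Finset.ne_of_mem_erase hD).symm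
    have := hBt.union key hdisj
    convert this using 1
    conv_lhs => rw [← Finset.insert_erase hBI, Finset.biUnion_insert,
      ← Finset.sdiff_union_of_subset htR]
    simp only [id]
    ac_rfl

end Matchings

section Degrees

variable {n : ℕ} {G : Fin n → Fin n → Prop}

/-- Ordered cyclic triangles with all vertices in `A`. -/
noncomputable def cycTriples (G : Fin n → Fin n → Prop) (A : Finset (Fin n)) :
    Finset (Fin n × Fin n × Fin n) :=
  (A ×ˢ A ×ˢ A).filter fun e => G e.1 e.2.1 ∧ G e.2.1 e.2.2 ∧ G e.2.2 e.1

/-- The number of cyclic triangles in `A` through `u`. -/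
noncomputable def cycDeg (G : Fin n → Fin n → Prop) (A : Finset (Fin n)) (u : Fin n) : ℕ :=
  ((A ×ˢ A).filter fun p => G u p.1 ∧ G p.1 p.2 ∧ G p.2 u).card

/-- The vertex set of an ordered triple. -/
def verts (e : Fin n × Fin n × Fin n) : Finset (Fin n) := {e.1, e.2.1, e.2.2}

lemma mem_cycTriples {A : Finset (Fin n)} {e : Fin n × Fin n × Fin n} :
    e ∈ cycTriples G A ↔ (e.1 ∈ A ∧ e.2.1 ∈ A ∧ e.2.2 ∈ A) ∧
      G e.1 e.2.1 ∧ G e.2.1 e.2.2 ∧ G e.2.2 e.1 := by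
  simp [cycTriples]

lemma verts_subset {A : Finset (Fin n)} {e : Fin n × Fin n × Fin n} (he : e ∈ cycTriples G A) :
    verts e ⊆ A := by
  obtain ⟨⟨h1, h2, h3⟩, -⟩ := mem_cycTriples.1 he
  simp [verts, Finset.insert_subset_iff, h1, h2, h3]

lemma isCycTri_verts {A : Finset (Fin n)} {e : Fin n × Fin n × Fin n} (he : e ∈ cycTriples G A) :
    IsCycTri G (verts e) := by
  obtain ⟨-, h1, h2, h3⟩ := mem_cycTriples.1 he
  exact ⟨_, _, _, h1, h2, h3, rfl⟩

lemma IsOriented.ne (hG : IsOriented G) {u v : Fin n} (h : G u v) : u ≠ v := by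
  rintro rfl
  exact hG.1 _ h

lemma sum_verts (hG : IsOriented G) {A : Finset (Fin n)} {e : Fin n × Fin n × Fin n}
    (he : e ∈ cycTriples G A) {M : Type*} [AddCommMonoid M] (f : Fin n → M) :
    ∑ v ∈ verts e, f v = f e.1 + f e.2.1 + f e.2.2 := by
  obtain ⟨-, h1, h2, h3⟩ := mem_cycTriples.1 he
  have h12 := hG.ne h1
  have h23 := hG.ne h2
  have h13 := (hG.ne h3).symm
  rw [verts, Finset.sum_insert (by simp [h12, h13]), Finset.sum_insert (by simp [h23]),
    Finset.sum_singleton, add_assoc]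

lemma card_verts (hG : IsOriented G) {A : Finset (Fin n)} {e : Fin n × Fin n × Fin n}
    (he : e ∈ cycTriples G A) : (verts e).card = 3 := by
  rw [Finset.card_eq_sum_ones, sum_verts hG he]

lemma sum_cycTriples_fst (A : Finset (Fin n)) (f : Fin n → ℝ) :
    ∑ e ∈ cycTriples G A, f e.1 = ∑ u ∈ A, f u * cycDeg G A u := by
  rw [cycTriples, Finset.sum_filter, Finset.sum_product]
  refine Finset.sum_congr rfl fun u _ => ?_
  simp only [← Finset.sum_filter, Finset.sum_const, nsmul_eq_mul]
  rw [mul_comm]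
  rfl

lemma sum_cycTriples_rotate (A : Finset (Fin n)) (F : Fin n × Fin n × Fin n → ℝ) :
    ∑ e ∈ cycTriples G A, F (e.2.1, e.2.2, e.1) = ∑ e ∈ cycTriples G A, F e := by
  refine Finset.sum_bij' (fun e _ => (e.2.1, e.2.2, e.1)) (fun e _ => (e.2.2, e.1, e.2.1))
    ?_ ?_ ?_ ?_ ?_
  · intro e he
    rw [mem_cycTriples] at he ⊢
    tauto
  · intro e he
    rw [mem_cycTriples] at he ⊢
    tauto
  · intro e _; rfl
  · intro e _; rfl
  · intro e _; rfl

lemma sum_sum_verts (hG : IsOriented G) (A : Finset (Fin n)) (f : Fin n → ℝ) :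
    ∑ e ∈ cycTriples G A, ∑ v ∈ verts e, f v = 3 * ∑ u ∈ A, f u * cycDeg G A u := by
  rw [Finset.sum_congr rfl fun e he => sum_verts hG he f, Finset.sum_add_distrib,
    Finset.sum_add_distrib]
  have h1 := sum_cycTriples_rotate (G := G) A fun e => f e.1
  have h2 := sum_cycTriples_rotate (G := G) A fun e => f e.2.1
  simp only at h1 h2
  rw [h2, h1, sum_cycTriples_fst]
  ring

lemma card_cycTriples (A : Finset (Fin n)) :
    ((cycTriples G A).card : ℝ) = ∑ u ∈ A, (cycDeg G A u : ℝ) := by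
  have := sum_cycTriples_fst (G := G) A fun _ => 1
  simpa using this

lemma outDegOn_union (v : Fin n) {A B : Finset (Fin n)} (h : Disjoint A B) :
    outDegOn G v (A ∪ B) = outDegOn G v A + outDegOn G v B := by
  rw [outDegOn, Finset.filter_union, Finset.card_union_of_disjoint]
  · rfl
  · exact Finset.disjoint_filter_filter h

lemma inDegOn_union (v : Fin n) {A B : Finset (Fin n)} (h : Disjoint A B) :
    inDegOn G v (A ∪ B) = inDegOn G v A + inDegOn G v B := by
  rw [inDegOn, Finset.filter_union, Finset.card_union_of_disjoint]
  · rfl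
  · exact Finset.disjoint_filter_filter h

lemma outDegOn_mono (v : Fin n) {A B : Finset (Fin n)} (h : A ⊆ B) :
    outDegOn G v A ≤ outDegOn G v B :=
  Finset.card_le_card (Finset.filter_subset_filter _ h)

lemma outDegOn_add_inDegOn_le (hG : IsOriented G) (v : Fin n) (A : Finset (Fin n)) :
    outDegOn G v A + inDegOn G v A ≤ A.card := by
  rw [outDegOn, inDegOn, ← Finset.card_union_of_disjoint]
  · exact Finset.card_le_card (Finset.union_subset (Finset.filter_subset _ _)
      (Finset.filter_subset _ _))
  · exact Finset.disjoint_filter.2 fun u _ h => hG.2 _ _ h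

lemma sum_outDegOn_eq_sum_inDegOn (A : Finset (Fin n)) :
    ∑ v ∈ A, outDegOn G v A = ∑ v ∈ A, inDegOn G v A := by
  simp only [outDegOn, inDegOn, Finset.card_filter]
  exact Finset.sum_comm

lemma cycDeg_eq_sum (A : Finset (Fin n)) (u : Fin n) :
    cycDeg G A u = ∑ y ∈ A.filter (fun y => G u y), outDegOn G y (A.filter fun z => G z u) := by
  rw [cycDeg, Finset.card_filter, Finset.sum_product, Finset.sum_filter]
  refine Finset.sum_congr rfl fun y _ => ?_
  rw [outDegOn, Finset.filter_filter, Finset.card_filter]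
  split_ifs with h
  · exact Finset.sum_congr rfl fun z _ => by simp [h, and_comm]
  · exact Finset.sum_eq_zero fun z _ => by simp [h]

/-- `A` is `E`-balanced: every vertex has in- and outdegree in `A` at least `|A| / 2 - E`. -/
def SemiBalanced (G : Fin n → Fin n → Prop) (A : Finset (Fin n)) (E : ℝ) : Prop :=
  ∀ v : Fin n, (A.card : ℝ) / 2 - E ≤ outDegOn G v A ∧ (A.card : ℝ) / 2 - E ≤ inDegOn G v A

lemma SemiBalanced.le_add (hG : IsOriented G) {A : Finset (Fin n)} {E : ℝ} (h : SemiBalanced G A E)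
    (v : Fin n) : (outDegOn G v A : ℝ) ≤ A.card / 2 + E ∧ (inDegOn G v A : ℝ) ≤ A.card / 2 + E := by
  have h1 : (outDegOn G v A : ℝ) + inDegOn G v A ≤ A.card := by
    exact_mod_cast outDegOn_add_inDegOn_le hG v A
  have := h v
  constructor <;> linarith [this.1, this.2]

lemma cycDeg_bounds (hG : IsOriented G) {A : Finset (Fin n)} {E : ℝ} (hE : 0 ≤ E)
    (hEA : E ≤ A.card / 100) (h : SemiBalanced G A E) (u : Fin n) :
    (A.card : ℝ) ^ 2 / 8 - 2 * A.card * E ≤ cycDeg G A u ∧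
      (cycDeg G A u : ℝ) ≤ (A.card : ℝ) ^ 2 / 8 + 2 * A.card * E := by
  set O := A.filter fun y => G u y with hO
  set I := A.filter fun z => G z u with hI
  set a : ℝ := (A.card : ℝ) with ha
  have hOd : (O.card : ℝ) = outDegOn G u A := rfl
  have hId : (I.card : ℝ) = inDegOn G u A := rfl
  have hOI : Disjoint O I := Finset.disjoint_filter.2 fun y _ h => hG.2 _ _ h
  have hOA : O ⊆ A := Finset.filter_subset _ _
  have hIA : I ⊆ A := Finset.filter_subset _ _
  have hcyc : (cycDeg G A u : ℝ) = ∑ y ∈ O, (outDegOn G y I : ℝ) := by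
    rw [cycDeg_eq_sum]; push_cast; rfl
  have hu := h u
  have hu' := h.le_add hG u
  rw [← hOd, ← hId] at hu hu'
  set d : ℝ := (O.card : ℝ) with hd
  set i : ℝ := (I.card : ℝ) with hi
  have hsumO : 2 * ∑ y ∈ O, (outDegOn G y O : ℝ)
      = ∑ y ∈ O, ((outDegOn G y O : ℝ) + inDegOn G y O) := by
    have : ∑ y ∈ O, (outDegOn G y O : ℝ) = ∑ y ∈ O, (inDegOn G y O : ℝ) := by
      exact_mod_cast sum_outDegOn_eq_sum_inDegOn O
    rw [Finset.sum_add_distrib, ← this]; ring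
  have hupO : 2 * ∑ y ∈ O, (outDegOn G y O : ℝ) ≤ d * d := by
    rw [hsumO]
    refine (Finset.sum_le_card_nsmul _ _ d fun y _ => ?_).trans_eq (by rw [nsmul_eq_mul])
    rw [hd]
    exact_mod_cast outDegOn_add_inDegOn_le hG y O
  have hloO : d * (d - 2 * E) ≤ 2 * ∑ y ∈ O, (outDegOn G y O : ℝ) := by
    rw [hsumO, hd, ← nsmul_eq_mul]
    refine Finset.card_nsmul_le_sum _ _ _ fun y _ => ?_
    have e1 : (outDegOn G y A : ℝ) = outDegOn G y O + outDegOn G y (A \ O) := by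
      rw [← Nat.cast_add, ← outDegOn_union y Finset.disjoint_sdiff,
        Finset.union_sdiff_of_subset hOA]
    have e2 : (inDegOn G y A : ℝ) = inDegOn G y O + inDegOn G y (A \ O) := by
      rw [← Nat.cast_add, ← inDegOn_union y Finset.disjoint_sdiff,
        Finset.union_sdiff_of_subset hOA]
    have e3 : (outDegOn G y (A \ O) : ℝ) + inDegOn G y (A \ O) ≤ a - d := by
      rw [ha, hd, ← Nat.cast_sub (Finset.card_le_card hOA), ← Finset.card_sdiff_of_subset hOA]
      exact_mod_cast outDegOn_add_inDegOn_le hG y (A \ O)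
    have := h y
    linarith [this.1, this.2]
  have hlow : d * (a / 2 - E - (a - d - i)) ≤ ∑ y ∈ O, (outDegOn G y O : ℝ)
      + ∑ y ∈ O, (outDegOn G y I : ℝ) := by
    rw [← Finset.sum_add_distrib, hd, ← nsmul_eq_mul]
    refine Finset.card_nsmul_le_sum _ _ _ fun y _ => ?_
    have e1 : (outDegOn G y A : ℝ) = outDegOn G y O + outDegOn G y I
        + outDegOn G y (A \ (O ∪ I)) := by
      rw [← Nat.cast_add, ← outDegOn_union y hOI, ← Nat.cast_add,
        ← outDegOn_union y Finset.disjoint_sdiff,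
        Finset.union_sdiff_of_subset (Finset.union_subset hOA hIA)]
    have e2 : (outDegOn G y (A \ (O ∪ I)) : ℝ) ≤ a - d - i := by
      have h1 : outDegOn G y (A \ (O ∪ I)) ≤ (A \ (O ∪ I)).card :=
        Finset.card_le_card (Finset.filter_subset _ _)
      have h2 : (A \ (O ∪ I)).card + (O.card + I.card) = A.card := by
        rw [← Finset.card_union_of_disjoint hOI]
        exact Finset.card_sdiff_add_card_eq_card (Finset.union_subset hOA hIA)
      have h3 : ((A \ (O ∪ I)).card : ℝ) + (d + i) = a := by
        rw [hd, hi, ha]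
        exact_mod_cast h2
      have h4 : (outDegOn G y (A \ (O ∪ I)) : ℝ) ≤ (A \ (O ∪ I)).card := by exact_mod_cast h1
      linarith
    linarith [(h y).1]
  have hupp : ∑ y ∈ O, (outDegOn G y O : ℝ) + ∑ y ∈ O, (outDegOn G y I : ℝ)
      ≤ d * (a / 2 + E) := by
    rw [← Finset.sum_add_distrib]
    refine (Finset.sum_le_card_nsmul _ _ (a / 2 + E) fun y _ => ?_).trans_eq (by rw [nsmul_eq_mul])
    refine le_trans ?_ (h.le_add hG y).1
    rw [← Nat.cast_add, ← outDegOn_union y hOI]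
    exact_mod_cast outDegOn_mono y (Finset.union_subset hOA hIA)
  rw [hcyc]
  have hd0 : 0 ≤ d := Nat.cast_nonneg _
  obtain ⟨s, hs⟩ : ∃ s, d = a / 2 + s := ⟨d - a / 2, by ring⟩
  have hs1 : -E ≤ s := by linarith [hu.1]
  have hs2 : s ≤ E := by linarith [hu'.1]
  have hss : s ^ 2 ≤ E ^ 2 := sq_le_sq' hs1 hs2
  have haE : E * E ≤ a / 100 * E := mul_le_mul_of_nonneg_right hEA hE
  have hsE : E * s ≤ E * E := mul_le_mul_of_nonneg_left hs2 hE
  constructor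
  · have hi' : d * (a / 2 - E - (a - d - (a / 2 - E))) ≤ d * (a / 2 - E - (a - d - i)) :=
      mul_le_mul_of_nonneg_left (by linarith [hu.2]) hd0
    rw [hs] at hi' hupO hlow
    nlinarith
  · rw [hs] at hloO hupp
    nlinarith

end Degrees

section Potential

variable {n : ℕ} {G : Fin n → Fin n → Prop}

/-- The amount by which `N` falls short of containing half of `A`. -/
noncomputable def dev (N A : Finset (Fin n)) : ℝ := ∑ v ∈ A, (1 / 2 - if v ∈ N then (1 : ℝ) else 0)

/-- The out-neighbourhood (`true`) or in-neighbourhood (`false`) of a vertex. -/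
noncomputable def nbr (G : Fin n → Fin n → Prop) (j : Fin n × Bool) : Finset (Fin n) :=
  univ.filter fun u => if j.2 then G j.1 u else G u j.1

/-- The exponential potential controlling all semidegrees into `A`. -/
noncomputable def potential (G : Fin n → Fin n → Prop) (t : ℝ) (A : Finset (Fin n)) : ℝ :=
  ∑ j, Real.exp (t * dev (nbr G j) A)

lemma dev_eq (N A : Finset (Fin n)) :
    dev N A = (A.card : ℝ) / 2 - (A.filter fun v => v ∈ N).card := by
  rw [dev, Finset.sum_sub_distrib, Finset.sum_const, Finset.card_filter, nsmul_eq_mul]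
  push_cast
  ring

lemma dev_nbr_true (v : Fin n) (A : Finset (Fin n)) :
    dev (nbr G (v, true)) A = (A.card : ℝ) / 2 - outDegOn G v A := by
  simp [dev_eq, nbr, outDegOn]

lemma dev_nbr_false (v : Fin n) (A : Finset (Fin n)) :
    dev (nbr G (v, false)) A = (A.card : ℝ) / 2 - inDegOn G v A := by
  simp [dev_eq, nbr, inDegOn]

lemma semiBalanced_of_dev_le {A : Finset (Fin n)} {E : ℝ} (h : ∀ j, dev (nbr G j) A ≤ E) :
    SemiBalanced G A E := by
  intro v
  have h1 := h (v, true)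
  have h2 := h (v, false)
  rw [dev_nbr_true] at h1
  rw [dev_nbr_false] at h2
  constructor <;> linarith

lemma SemiBalanced.neg_le_dev (hG : IsOriented G) {A : Finset (Fin n)} {E : ℝ}
    (h : SemiBalanced G A E) (j : Fin n × Bool) : -E ≤ dev (nbr G j) A := by
  obtain ⟨v, _ | _⟩ := j
  · rw [dev_nbr_false]; linarith [(h.le_add hG v).2]
  · rw [dev_nbr_true]; linarith [(h.le_add hG v).1]

lemma semiBalanced_of_potential_le {A : Finset (Fin n)} {E t : ℝ} (ht : 0 < t)
    (h : potential G t A ≤ Real.exp (t * E)) : SemiBalanced G A E := by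
  refine semiBalanced_of_dev_le fun j => ?_
  have h1 : Real.exp (t * dev (nbr G j) A) ≤ Real.exp (t * E) :=
    (Finset.single_le_sum (f := fun j => Real.exp (t * dev (nbr G j) A))
      (fun j _ => (Real.exp_pos _).le) (Finset.mem_univ j)).trans h
  exact le_of_mul_le_mul_left (Real.exp_le_exp.1 h1) ht

lemma dev_sdiff (N : Finset (Fin n)) {A B : Finset (Fin n)} (h : B ⊆ A) :
    dev N (A \ B) = dev N A - dev N B := by
  rw [dev, dev, dev, eq_sub_iff_add_eq, Finset.sum_sdiff h]

lemma abs_dev_le (N A : Finset (Fin n)) : |dev N A| ≤ A.card / 2 := by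
  refine (Finset.abs_sum_le_sum_abs _ _).trans
    ((Finset.sum_le_card_nsmul _ _ (1 / 2 : ℝ) fun v _ => ?_).trans_eq ?_)
  · split_ifs <;> norm_num [abs_of_pos, abs_of_neg]
  · rw [nsmul_eq_mul]; ring

lemma card_cycTriples_ge (hG : IsOriented G) {A : Finset (Fin n)} {E : ℝ} (hE : 0 ≤ E)
    (hEA : E ≤ A.card / 100) (h : SemiBalanced G A E) :
    (A.card : ℝ) ^ 3 / 10 ≤ (cycTriples G A).card := by
  rw [card_cycTriples]
  have h1 := Finset.card_nsmul_le_sum A (fun u => (cycDeg G A u : ℝ)) _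
    fun u _ => (cycDeg_bounds hG hE hEA h u).1
  rw [nsmul_eq_mul] at h1
  refine le_trans ?_ h1
  have ha : (0 : ℝ) ≤ A.card := Nat.cast_nonneg _
  have h2 : (A.card : ℝ) ^ 2 * E ≤ (A.card : ℝ) ^ 2 * (A.card / 100) :=
    mul_le_mul_of_nonneg_left hEA (by positivity)
  have h3 : (0 : ℝ) ≤ (A.card : ℝ) ^ 3 := by positivity
  nlinarith

lemma card_cycTriples_le (A : Finset (Fin n)) : (cycTriples G A).card ≤ A.card ^ 3 := by
  refine (Finset.card_filter_le _ _).trans_eq ?_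
  rw [Finset.card_product, Finset.card_product]; ring

lemma cycDeg_le (A : Finset (Fin n)) (u : Fin n) : cycDeg G A u ≤ A.card ^ 2 := by
  refine (Finset.card_filter_le _ _).trans_eq ?_
  rw [Finset.card_product]; ring

lemma sum_exp_dev_le (hG : IsOriented G) {A : Finset (Fin n)} {E t : ℝ} (hA : 0 < A.card)
    (hE : 0 ≤ E) (hEA : E ≤ A.card / 100) (h : SemiBalanced G A E) {N : Finset (Fin n)}
    (hN : -E ≤ dev N A) (ht : 0 ≤ t) (ht' : t ≤ 1 / 2) :
    ∑ e ∈ cycTriples G A, Real.exp (-(t * dev N (verts e))) ≤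
      (cycTriples G A).card * Real.exp (t * (120 * E / A.card + 3 * t)) := by
  set a : ℝ := (A.card : ℝ) with ha
  set T := cycTriples G A with hT
  have ha0 : 0 < a := by rw [ha]; exact_mod_cast hA
  have hcard : a ^ 3 / 10 ≤ T.card := card_cycTriples_ge hG hE hEA h
  have hsum : ∑ e ∈ T, -(dev N (verts e)) ≤ T.card * (120 * E / a) := by
    have h1 : ∑ e ∈ T, dev N (verts e)
        = 3 * ∑ u ∈ A, (1 / 2 - if u ∈ N then (1 : ℝ) else 0) * cycDeg G A u :=
      sum_sum_verts hG A _
    have h2 : a ^ 2 / 8 * dev N A - a * (a * E)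
        ≤ ∑ u ∈ A, (1 / 2 - if u ∈ N then (1 : ℝ) else 0) * cycDeg G A u := by
      rw [dev, Finset.mul_sum, sub_le_iff_le_add, ha, ← nsmul_eq_mul, ← Finset.sum_const,
        ← Finset.sum_add_distrib]
      refine Finset.sum_le_sum fun u _ => ?_
      have := cycDeg_bounds hG hE hEA h u
      rw [← ha] at this ⊢
      split_ifs <;> linarith [this.1, this.2]
    have h3 : a ^ 2 / 8 * (-E) ≤ a ^ 2 / 8 * dev N A :=
      mul_le_mul_of_nonneg_left hN (by positivity)
    have h4 : a ^ 3 / 10 * (120 * E / a) ≤ T.card * (120 * E / a) :=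
      mul_le_mul_of_nonneg_right hcard (by positivity)
    have h5 : a ^ 3 / 10 * (120 * E / a) = 12 * a ^ 2 * E := by field_simp; ring
    rw [Finset.sum_neg_distrib, h1]
    nlinarith [mul_nonneg (sq_nonneg a) hE]
  calc ∑ e ∈ T, Real.exp (-(t * dev N (verts e)))
      ≤ ∑ e ∈ T, (1 + t * -(dev N (verts e)) + 3 * t ^ 2) := by
        refine Finset.sum_le_sum fun e he => ?_
        have h1 : |dev N (verts e)| ≤ 3 / 2 := by
          refine (abs_dev_le _ _).trans_eq ?_
          rw [card_verts hG he]; norm_num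
        have h2 : |-(t * dev N (verts e))| ≤ t * (3 / 2) := by
          rw [abs_neg, abs_mul, abs_of_nonneg ht]
          exact mul_le_mul_of_nonneg_left h1 ht
        have h3 := Real.abs_exp_sub_one_sub_id_le (h2.trans (by linarith))
        have h4 : (-(t * dev N (verts e))) ^ 2 ≤ (t * (3 / 2)) ^ 2 := by
          rw [← sq_abs]; exact pow_le_pow_left₀ (abs_nonneg _) h2 2
        have h5 := (abs_le.1 h3).2
        nlinarith [sq_nonneg t]
    _ = T.card * (1 + 3 * t ^ 2) + t * ∑ e ∈ T, -(dev N (verts e)) := by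
        rw [Finset.mul_sum, ← nsmul_eq_mul, ← Finset.sum_const, ← Finset.sum_add_distrib]
        exact Finset.sum_congr rfl fun e _ => by ring
    _ ≤ T.card * (1 + 3 * t ^ 2) + t * (T.card * (120 * E / a)) := by gcongr
    _ = T.card * (t * (120 * E / a + 3 * t) + 1) := by ring
    _ ≤ _ := by
        gcongr
        exact Real.add_one_le_exp _

end Potential

section Blocks

variable {n : ℕ} {G : Fin n → Fin n → Prop} {ι : Type} [Fintype ι]

/-- The vertex set of a family of ordered triples. -/
noncomputable def blockVerts (τ : ι → Fin n × Fin n × Fin n) : Finset (Fin n) :=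
  univ.biUnion fun k => verts (τ k)

/-- Families of pairwise vertex-disjoint ordered cyclic triangles in `A`, indexed by `ι`. -/
noncomputable def blocks (G : Fin n → Fin n → Prop) (A : Finset (Fin n)) (ι : Type) [Fintype ι] :
    Finset (ι → Fin n × Fin n × Fin n) :=
  (Fintype.piFinset fun _ => cycTriples G A).filter fun τ =>
    Pairwise fun i j => Disjoint (verts (τ i)) (verts (τ j))

lemma mem_blocks {A : Finset (Fin n)} {τ : ι → Fin n × Fin n × Fin n} :
    τ ∈ blocks G A ι ↔ (∀ k, τ k ∈ cycTriples G A) ∧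
      Pairwise fun i j => Disjoint (verts (τ i)) (verts (τ j)) := by
  simp [blocks]

lemma blockVerts_subset {A : Finset (Fin n)} {τ : ι → Fin n × Fin n × Fin n}
    (hτ : τ ∈ blocks G A ι) : blockVerts τ ⊆ A :=
  Finset.biUnion_subset.2 fun k _ => verts_subset ((mem_blocks.1 hτ).1 k)

lemma hasCycPM_blockVerts {A : Finset (Fin n)} {τ : ι → Fin n × Fin n × Fin n}
    (hτ : τ ∈ blocks G A ι) : HasCycPM G (blockVerts τ) := by
  refine hasCycPM_biUnion (fun i _ j _ hij => (mem_blocks.1 hτ).2 hij) fun k _ => ?_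
  exact (isCycTri_verts ((mem_blocks.1 hτ).1 k)).hasCycPM

lemma sum_blockVerts {A : Finset (Fin n)} {τ : ι → Fin n × Fin n × Fin n}
    (hτ : τ ∈ blocks G A ι) {M : Type*} [AddCommMonoid M] (f : Fin n → M) :
    ∑ v ∈ blockVerts τ, f v = ∑ k, ∑ v ∈ verts (τ k), f v :=
  Finset.sum_biUnion fun _ _ _ _ hij => (mem_blocks.1 hτ).2 hij

lemma card_blockVerts (hG : IsOriented G) {A : Finset (Fin n)} {τ : ι → Fin n × Fin n × Fin n}
    (hτ : τ ∈ blocks G A ι) : (blockVerts τ).card = 3 * Fintype.card ι := by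
  rw [Finset.card_eq_sum_ones, sum_blockVerts hτ,
    Finset.sum_congr rfl fun k _ => by
      rw [← Finset.card_eq_sum_ones, card_verts hG ((mem_blocks.1 hτ).1 k)]]
  simp [mul_comm]

lemma sum_piFinset_prod (T : Finset (Fin n × Fin n × Fin n)) (f : Fin n × Fin n × Fin n → ℝ) :
    ∑ τ ∈ Fintype.piFinset (fun _ : ι => T), ∏ k, f (τ k) = (∑ e ∈ T, f e) ^ Fintype.card ι := by
  rw [← Finset.prod_univ_sum (fun _ : ι => T) fun _ e => f e, Finset.prod_const, Finset.card_univ]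

lemma card_blocks_ge (hG : IsOriented G) {A : Finset (Fin n)} {E : ℝ} (hA : 0 < A.card)
    (hE : 0 ≤ E) (hEA : E ≤ A.card / 100) (h : SemiBalanced G A E) :
    ((cycTriples G A).card : ℝ) ^ Fintype.card ι * (1 - 31 ^ Fintype.card ι / A.card)
      ≤ (blocks G A ι).card := by
  set a : ℝ := (A.card : ℝ) with ha
  set T := cycTriples G A with hT
  set q := Fintype.card ι with hq
  have ha1 : 1 ≤ a := by rw [ha]; exact_mod_cast hA
  have hcard : a ^ 3 / 10 ≤ T.card := card_cycTriples_ge hG hE hEA h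
  set P := Fintype.piFinset fun _ : ι => T with hP
  have hPc : (P.card : ℝ) = (T.card : ℝ) ^ q := by
    rw [hP, Fintype.card_piFinset]
    simp [hq]
  set bad := P.filter fun τ => ¬ Pairwise fun i j => Disjoint (verts (τ i)) (verts (τ j)) with hbad
  have hsplit : ((blocks G A ι).card : ℝ) + bad.card = P.card := by
    exact_mod_cast Finset.card_filter_add_card_filter_not _
  let w : Fin n → Fin n × Fin n × Fin n → ℝ := fun v e => if v ∈ verts e then a else 1
  have hw1 : ∀ v e, 1 ≤ w v e := fun v e => by
    simp only [w]; split_ifs <;> simp [ha1]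
  have hw : ∀ v, ∑ e ∈ T, w v e ≤ 31 * T.card := by
    intro v
    have h1 : ∑ e ∈ T, ∑ u ∈ verts e, (if u = v then (1 : ℝ) else 0) ≤ 3 * a ^ 2 := by
      rw [hT, sum_sum_verts hG]
      gcongr
      simp only [ite_mul, one_mul, zero_mul, Finset.sum_ite_eq']
      split_ifs
      · rw [ha]; exact_mod_cast cycDeg_le A v
      · positivity
    calc ∑ e ∈ T, w v e ≤ ∑ e ∈ T, (1 + a * ∑ u ∈ verts e, (if u = v then (1 : ℝ) else 0)) := by
          refine Finset.sum_le_sum fun e _ => ?_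
          simp only [w, Finset.sum_ite_eq']
          split_ifs <;> linarith
      _ = T.card + a * ∑ e ∈ T, ∑ u ∈ verts e, (if u = v then (1 : ℝ) else 0) := by
          rw [Finset.sum_add_distrib, ← Finset.mul_sum]; simp
      _ ≤ T.card + a * (3 * a ^ 2) := by gcongr
      _ ≤ 31 * T.card := by nlinarith
  have hbadc : (bad.card : ℝ) ≤ (T.card : ℝ) ^ q * (31 ^ q / a) := by
    calc (bad.card : ℝ) = ∑ τ ∈ bad, (1 : ℝ) := by simp
      _ ≤ ∑ τ ∈ bad, ∑ v ∈ A, (∏ k, w v (τ k)) / a ^ 2 := by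
          refine Finset.sum_le_sum fun τ hτ => ?_
          obtain ⟨hτP, hτ⟩ := Finset.mem_filter.1 hτ
          simp only [Pairwise, not_forall] at hτ
          obtain ⟨i, j, hij, hd⟩ := hτ
          obtain ⟨v, hvi, hvj⟩ := Finset.not_disjoint_iff.1 hd
          have hvA : v ∈ A := verts_subset (Fintype.mem_piFinset.1 hτP i) hvi
          have h2 : a ^ 2 ≤ ∏ k, w v (τ k) := by
            calc a ^ 2 = ∏ k ∈ {i, j}, w v (τ k) := by
                  rw [Finset.prod_pair hij]; simp [w, hvi, hvj, sq]
              _ ≤ ∏ k, w v (τ k) := by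
                  exact Finset.prod_le_prod_of_subset_of_one_le (Finset.subset_univ _)
                    (fun k _ => zero_le_one.trans (hw1 _ _)) fun k _ _ => hw1 _ _
          have h3 : 1 ≤ (∏ k, w v (τ k)) / a ^ 2 := by rwa [one_le_div (by positivity)]
          refine h3.trans (Finset.single_le_sum (f := fun v => (∏ k, w v (τ k)) / a ^ 2)
            (fun u _ => ?_) hvA)
          exact div_nonneg (Finset.prod_nonneg fun k _ => zero_le_one.trans (hw1 _ _))
            (by positivity)
      _ ≤ ∑ τ ∈ P, ∑ v ∈ A, (∏ k, w v (τ k)) / a ^ 2 := by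
          refine Finset.sum_le_sum_of_subset_of_nonneg (Finset.filter_subset _ _) fun τ _ _ => ?_
          exact Finset.sum_nonneg fun v _ =>
            div_nonneg (Finset.prod_nonneg fun k _ => zero_le_one.trans (hw1 _ _)) (by positivity)
      _ = ∑ v ∈ A, (∑ e ∈ T, w v e) ^ q / a ^ 2 := by
          rw [Finset.sum_comm]
          refine Finset.sum_congr rfl fun v _ => ?_
          rw [← Finset.sum_div, hP, sum_piFinset_prod]
      _ ≤ ∑ v ∈ A, (31 * T.card : ℝ) ^ q / a ^ 2 := by
          refine Finset.sum_le_sum fun v _ => ?_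
          have : 0 ≤ ∑ e ∈ T, w v e := Finset.sum_nonneg fun e _ => zero_le_one.trans (hw1 _ _)
          gcongr
          exact hw v
      _ = (T.card : ℝ) ^ q * (31 ^ q / a) := by
          rw [Finset.sum_const, nsmul_eq_mul, ← ha, mul_pow]; field_simp
  rw [mul_sub, mul_one, ← hPc]
  rw [← hPc] at hbadc
  linarith

lemma exists_block (hG : IsOriented G) {A : Finset (Fin n)} {E t : ℝ} (hA : 0 < A.card)
    (hE : 0 ≤ E) (hEA : E ≤ A.card / 100) (h : SemiBalanced G A E) (ht : 0 ≤ t) (ht' : t ≤ 1 / 2)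
    (hsmall : (31 : ℝ) ^ Fintype.card ι / A.card < 1) (F : Finset (Fin n) → ℝ) {x P : ℝ}
    (hx : 0 ≤ x) (hP : 0 ≤ P)
    (hF : ∑ τ ∈ blocks G A ι, F (blockVerts τ) ≤ P * ((cycTriples G A).card : ℝ) ^ Fintype.card ι) :
    ∃ τ ∈ blocks G A ι, (x * potential G t (A \ blockVerts τ) + F (blockVerts τ)) *
        (1 - 31 ^ Fintype.card ι / A.card) ≤
      x * (potential G t A * Real.exp (t * (120 * E / A.card + 3 * t)) ^ Fintype.card ι) + P := by
  set T := cycTriples G A with hT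
  set q := Fintype.card ι with hq
  set r := Real.exp (t * (120 * E / A.card + 3 * t)) with hr
  set δ : ℝ := 31 ^ q / A.card with hδ
  have hTpos : (0 : ℝ) < T.card := by
    have : (0 : ℝ) < A.card := by exact_mod_cast hA
    exact lt_of_lt_of_le (by positivity) (card_cycTriples_ge hG hE hEA h)
  have hb : (T.card : ℝ) ^ q * (1 - δ) ≤ (blocks G A ι).card := card_blocks_ge hG hA hE hEA h
  have hpot : ∑ τ ∈ blocks G A ι, potential G t (A \ blockVerts τ)
      ≤ (T.card : ℝ) ^ q * (potential G t A * r ^ q) := by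
    simp only [potential]
    rw [Finset.sum_comm, Finset.sum_mul, Finset.mul_sum]
    refine Finset.sum_le_sum fun j _ => ?_
    calc ∑ τ ∈ blocks G A ι, Real.exp (t * dev (nbr G j) (A \ blockVerts τ))
        = ∑ τ ∈ blocks G A ι, Real.exp (t * dev (nbr G j) A) *
            ∏ k, Real.exp (-(t * dev (nbr G j) (verts (τ k)))) := by
          refine Finset.sum_congr rfl fun τ hτ => ?_
          rw [dev_sdiff _ (blockVerts_subset hτ), ← Real.exp_sum, ← Real.exp_add]
          congr 1
          have : dev (nbr G j) (blockVerts τ) = ∑ k, dev (nbr G j) (verts (τ k)) :=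
            sum_blockVerts hτ _
          rw [this, Finset.sum_neg_distrib, ← Finset.mul_sum]; ring
      _ ≤ ∑ τ ∈ Fintype.piFinset (fun _ : ι => T), Real.exp (t * dev (nbr G j) A) *
            ∏ k, Real.exp (-(t * dev (nbr G j) (verts (τ k)))) :=
          Finset.sum_le_sum_of_subset_of_nonneg (Finset.filter_subset _ _)
            fun τ _ _ => by positivity
      _ = Real.exp (t * dev (nbr G j) A) *
            (∑ e ∈ T, Real.exp (-(t * dev (nbr G j) (verts e)))) ^ q := by
          rw [← Finset.mul_sum,
            sum_piFinset_prod T fun e => Real.exp (-(t * dev (nbr G j) (verts e)))]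
      _ ≤ Real.exp (t * dev (nbr G j) A) * (T.card * r) ^ q := by
          gcongr
          exact sum_exp_dev_le hG hA hE hEA h (h.neg_le_dev hG j) ht ht'
      _ = _ := by rw [mul_pow]; ring
  have hne : (blocks G A ι).Nonempty := by
    rw [← Finset.card_pos]
    have : (0 : ℝ) < (blocks G A ι).card :=
      lt_of_lt_of_le (mul_pos (pow_pos hTpos q) (by linarith)) hb
    exact_mod_cast this
  have hpot0 : 0 ≤ potential G t A := Finset.sum_nonneg fun j _ => (Real.exp_pos _).le
  refine Finset.exists_le_of_sum_le hne ?_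
  rw [← Finset.sum_mul, Finset.sum_add_distrib, ← Finset.mul_sum, Finset.sum_const, nsmul_eq_mul]
  have hR : 0 ≤ x * (potential G t A * r ^ q) + P := by positivity
  calc (x * ∑ τ ∈ blocks G A ι, potential G t (A \ blockVerts τ)
        + ∑ τ ∈ blocks G A ι, F (blockVerts τ)) * (1 - δ)
      ≤ (x * ((T.card : ℝ) ^ q * (potential G t A * r ^ q)) + P * (T.card : ℝ) ^ q) * (1 - δ) := by
        have : 0 ≤ 1 - δ := by linarith
        gcongr
    _ = ((T.card : ℝ) ^ q * (1 - δ)) * (x * (potential G t A * r ^ q) + P) := by ring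
    _ ≤ _ := by gcongr

end Blocks

section Linking

variable {n : ℕ} {G : Fin n → Fin n → Prop}

lemma card_filter_not_disjoint_le (k : ℕ) (Z : Finset (Fin n)) :
    ((powersetCard (k + 1) (univ : Finset (Fin n))).filter fun S => ¬ Disjoint S Z).card
      ≤ Z.card * n ^ k := by
  calc _ ≤ (Z.biUnion fun z => (powersetCard k (univ : Finset (Fin n))).image (insert z)).card := by
        refine Finset.card_le_card fun S hS => ?_
        rw [Finset.mem_filter, Finset.mem_powersetCard_univ] at hS
        obtain ⟨z, hzS, hzZ⟩ := Finset.not_disjoint_iff.1 hS.2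
        refine Finset.mem_biUnion.2 ⟨z, hzZ, Finset.mem_image.2 ⟨S.erase z, ?_, ?_⟩⟩
        · rw [Finset.mem_powersetCard_univ, Finset.card_erase_of_mem hzS, hS.1]; rfl
        · exact Finset.insert_erase hzS
    _ ≤ Z.card * n ^ k := by
        refine Finset.card_biUnion_le_card_mul _ _ _ fun z _ => Finset.card_image_le.trans ?_
        rw [Finset.card_powersetCard, Finset.card_univ, Fintype.card_fin]
        exact Nat.choose_le_pow n k

lemma IsCycTri.exists_triple {A s : Finset (Fin n)} (hs : IsCycTri G s) (hsA : s ⊆ A) (x : Fin n) :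
    ∃ e ∈ cycTriples G A, verts e = s ∧ (x ∈ s → e.1 = x) := by
  obtain ⟨a, b, c, hab, hbc, hca, rfl⟩ := hs
  have ha : a ∈ A := hsA (by simp)
  have hb : b ∈ A := hsA (by simp)
  have hc : c ∈ A := hsA (by simp)
  by_cases hxb : x = b
  · refine ⟨(b, c, a), mem_cycTriples.2 ⟨⟨hb, hc, ha⟩, hbc, hca, hab⟩, ?_, fun _ => hxb.symm⟩
    ext u; simp only [verts, Finset.mem_insert, Finset.mem_singleton]; tauto
  by_cases hxc : x = c
  · refine ⟨(c, a, b), mem_cycTriples.2 ⟨⟨hc, ha, hb⟩, hca, hab, hbc⟩, ?_, fun _ => hxc.symm⟩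
    ext u; simp only [verts, Finset.mem_insert, Finset.mem_singleton]; tauto
  · refine ⟨(a, b, c), mem_cycTriples.2 ⟨⟨ha, hb, hc⟩, hab, hbc, hca⟩, rfl, fun hx => ?_⟩
    simpa [hxb, hxc, eq_comm] using hx

/-- A tiled set of size `3 * ℓ` is the vertex set of a block whose first vertex is prescribed. -/
lemma HasCycPM.exists_block {ℓ : ℕ} [NeZero ℓ] (hG : IsOriented G) {A W : Finset (Fin n)}
    (h : HasCycPM G W) (hW : W.card = 3 * ℓ) (hWA : W ⊆ A) {x : Fin n} (hx : x ∈ W) :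
    ∃ τ ∈ blocks G A (Fin ℓ), blockVerts τ = W ∧ (τ 0).1 = x := by
  obtain ⟨C, ⟨hC, hCd⟩, rfl⟩ := h
  have hCA : ∀ s ∈ C, s ⊆ A := fun s hs => (Finset.subset_biUnion_of_mem id hs).trans hWA
  have : Nonempty (Fin n × Fin n × Fin n) := ⟨(x, x, x)⟩
  choose! f hfA hfv hfx using fun s (hs : s ∈ C) => (hC s hs).exists_triple (hCA s hs) x
  have hcard : C.card = ℓ := by
    have h := Finset.card_biUnion (t := id) fun s hs t ht hst => hCd s hs t ht hst
    rw [hW, Finset.sum_congr rfl fun s hs => (by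
      rw [id, ← card_verts hG (hfA s hs), hfv s hs] : (id s).card = 3), Finset.sum_const,
      smul_eq_mul] at h
    omega
  obtain ⟨s₀, hs₀, hxs₀⟩ := Finset.mem_biUnion.1 hx
  let e₀ : Fin ℓ ≃ C := (C.equivFinOfCardEq hcard).symm
  let e : Fin ℓ ≃ C := (Equiv.swap 0 (e₀.symm ⟨s₀, hs₀⟩)).trans e₀
  have he0 : e 0 = ⟨s₀, hs₀⟩ := by simp [e]
  have hv : ∀ k, verts (f (e k)) = (e k : Finset (Fin n)) := fun k => hfv _ (e k).2
  refine ⟨fun k => f (e k), mem_blocks.2 ⟨fun k => hfA _ (e k).2, fun i j hij => ?_⟩, ?_, ?_⟩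
  · simp only [hv]
    exact hCd _ (e i).2 _ (e j).2 fun h => hij (e.injective (Subtype.ext h))
  · ext v
    simp only [blockVerts, hv, Finset.mem_biUnion, Finset.mem_univ, true_and, id]
    constructor
    · rintro ⟨k, hk⟩; exact ⟨_, (e k).2, hk⟩
    · rintro ⟨s, hs, hvs⟩; exact ⟨e.symm ⟨s, hs⟩, by simpa using hvs⟩
  · simp only [he0]
    exact hfx s₀ hs₀ hxs₀

/-- Blocks in `A` with first vertex `x'` whose remaining vertices avoid `W` and also form a tiled
set together with `x`. -/
noncomputable def linkBlocks (G : Fin n → Fin n → Prop) (ℓ : ℕ) [NeZero ℓ]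
    (A W : Finset (Fin n)) (x x' : Fin n) : Finset (Fin ℓ → Fin n × Fin n × Fin n) :=
  (blocks G A (Fin ℓ)).filter fun τ => (τ 0).1 = x' ∧ x ∉ (blockVerts τ).erase x' ∧
    HasCycPM G (insert x ((blockVerts τ).erase x')) ∧ Disjoint ((blockVerts τ).erase x') W

lemma card_linkBlocks_ge {ℓ : ℕ} [NeZero ℓ] (hG : IsOriented G) {β : ℝ} {A W : Finset (Fin n)}
    {x x' : Fin n} (hx' : x' ∈ A) (hlink : β * (n : ℝ) ^ (3 * ℓ - 1) ≤ linkCount G ℓ x x')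
    (hsmall : ((Aᶜ ∪ W).card : ℝ) ≤ β / 2 * n) :
    β / 2 * (n : ℝ) ^ (3 * ℓ - 1) ≤ (linkBlocks G ℓ A W x x').card := by
  have hℓ : 3 * ℓ - 1 = 3 * ℓ - 2 + 1 := by
    have := NeZero.pos ℓ; omega
  set L := (powersetCard (3 * ℓ - 1) (univ : Finset (Fin n))).filter fun S =>
    x ∉ S ∧ x' ∉ S ∧ HasCycPM G (insert x S) ∧ HasCycPM G (insert x' S) with hL
  set bad := (powersetCard (3 * ℓ - 1) (univ : Finset (Fin n))).filter
    fun S => ¬ Disjoint S (Aᶜ ∪ W) with hbad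
  have h1 : (L \ bad).card ≤ (linkBlocks G ℓ A W x x').card := by
    refine Finset.card_le_card_of_surjOn (fun τ => (blockVerts τ).erase x') fun S hS => ?_
    rw [Finset.mem_coe, Finset.mem_sdiff, hL, hbad, Finset.mem_filter, Finset.mem_filter] at hS
    obtain ⟨⟨hSc, hxS, hxS', hPM, hPM'⟩, hSb⟩ := hS
    have hd : Disjoint S (Aᶜ ∪ W) := by
      by_contra hd; exact hSb ⟨hSc, hd⟩
    rw [Finset.mem_powersetCard_univ] at hSc
    rw [Finset.disjoint_union_right] at hd
    have hSA : S ⊆ A := fun v hv => by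
      by_contra hvA
      exact Finset.disjoint_left.1 hd.1 hv (Finset.mem_compl.2 hvA)
    obtain ⟨τ, hτ, hτS, hτx⟩ := hPM'.exists_block hG (A := A) (ℓ := ℓ)
      (by rw [Finset.card_insert_of_notMem hxS', hSc]; omega)
      (Finset.insert_subset hx' hSA) (Finset.mem_insert_self x' S)
    have hE : (blockVerts τ).erase x' = S := by rw [hτS, Finset.erase_insert hxS']
    refine ⟨τ, ?_, hE⟩
    rw [Finset.mem_coe, linkBlocks, Finset.mem_filter, hE]
    exact ⟨hτ, hτx, hxS, hPM, hd.2⟩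
  have h2 : L.card ≤ (L \ bad).card + bad.card := by
    have := Finset.card_le_card (Finset.subset_union_left (s₁ := L) (s₂ := bad))
    rw [← Finset.sdiff_union_self_eq_union] at this
    exact this.trans (Finset.card_union_le _ _)
  have h3 : bad.card ≤ (Aᶜ ∪ W).card * n ^ (3 * ℓ - 2) := by
    rw [hbad, hℓ]; exact card_filter_not_disjoint_le _ _
  have h4 : (bad.card : ℝ) ≤ β / 2 * (n : ℝ) ^ (3 * ℓ - 1) := by
    calc (bad.card : ℝ) ≤ (Aᶜ ∪ W).card * (n : ℝ) ^ (3 * ℓ - 2) := by exact_mod_cast h3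
      _ ≤ β / 2 * n * (n : ℝ) ^ (3 * ℓ - 2) := by gcongr
      _ = _ := by rw [hℓ, pow_succ]; ring
  have h5 : (L.card : ℝ) ≤ (linkBlocks G ℓ A W x x').card + bad.card := by
    exact_mod_cast h2.trans (Nat.add_le_add_right h1 _)
  have h6 : (linkCount G ℓ x x' : ℝ) = L.card := rfl
  linarith

lemma card_mul_le_card_sigma {α : Type*} {σ : α → Type*} (S : Finset α) (f : ∀ a, Finset (σ a))
    {q : ℝ} (h : ∀ a ∈ S, q ≤ (f a).card) : S.card * q ≤ ((S.sigma f).card : ℝ) := by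
  rw [Finset.card_sigma, ← nsmul_eq_mul, Nat.cast_sum]
  exact Finset.card_nsmul_le_sum _ _ _ h

/-- Three linked blocks, hung on a cyclic triangle, form a block that absorbs a triple. -/
lemma absorbing_of_linkBlocks {ℓ : ℕ} [NeZero ℓ] (hG : IsOriented G) {A : Finset (Fin n)}
    {x y z : Fin n} (hxy : x ≠ y) (hxz : x ≠ z) (hyz : y ≠ z)
    {e : Fin n × Fin n × Fin n} (he : e ∈ cycTriples G (A \ {x, y, z}))
    {σ₁ σ₂ σ₃ : Fin ℓ → Fin n × Fin n × Fin n}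
    (h₁ : σ₁ ∈ linkBlocks G ℓ A ({x, y, z} ∪ verts e) x e.1)
    (h₂ : σ₂ ∈ linkBlocks G ℓ A ({x, y, z} ∪ verts e ∪ blockVerts σ₁) y e.2.1)
    (h₃ : σ₃ ∈ linkBlocks G ℓ A ({x, y, z} ∪ verts e ∪ blockVerts σ₁ ∪ blockVerts σ₂) z e.2.2) :
    (fun p : Fin 3 × Fin ℓ => ![σ₁, σ₂, σ₃] p.1 p.2) ∈ blocks G A (Fin 3 × Fin ℓ) ∧
      HasCycPM G (blockVerts (fun p : Fin 3 × Fin ℓ => ![σ₁, σ₂, σ₃] p.1 p.2) ∪ {x, y, z}) := by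
  obtain ⟨hb₁, hf₁, hx₁, hP₁, hd₁⟩ := Finset.mem_filter.1 h₁
  obtain ⟨hb₂, hf₂, hx₂, hP₂, hd₂⟩ := Finset.mem_filter.1 h₂
  obtain ⟨hb₃, hf₃, hx₃, hP₃, hd₃⟩ := Finset.mem_filter.1 h₃
  obtain ⟨-, g12, g23, g31⟩ := mem_cycTriples.1 he
  have n12 := hG.ne g12
  have n23 := hG.ne g23
  have n31 := hG.ne g31
  have het : Disjoint (verts e) {x, y, z} :=
    Finset.disjoint_of_subset_left (verts_subset he) Finset.sdiff_disjoint
  have hmem : ∀ (σ : Fin ℓ → Fin n × Fin n × Fin n), (σ 0).1 ∈ blockVerts σ := fun σ =>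
    Finset.mem_biUnion.2 ⟨0, Finset.mem_univ _, by simp [verts]⟩
  have m₁ : insert e.1 ((blockVerts σ₁).erase e.1) = blockVerts σ₁ :=
    Finset.insert_erase (hf₁ ▸ hmem σ₁)
  have m₂ : insert e.2.1 ((blockVerts σ₂).erase e.2.1) = blockVerts σ₂ :=
    Finset.insert_erase (hf₂ ▸ hmem σ₂)
  have m₃ : insert e.2.2 ((blockVerts σ₃).erase e.2.2) = blockVerts σ₃ :=
    Finset.insert_erase (hf₃ ▸ hmem σ₃)
  set S₁ := (blockVerts σ₁).erase e.1
  set S₂ := (blockVerts σ₂).erase e.2.1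
  set S₃ := (blockVerts σ₃).erase e.2.2
  simp only [Finset.disjoint_union_right] at hd₁ hd₂ hd₃
  obtain ⟨hd₁t, hd₁e⟩ := hd₁
  obtain ⟨⟨hd₂t, hd₂e⟩, hd₂₁⟩ := hd₂
  obtain ⟨⟨⟨hd₃t, hd₃e⟩, hd₃₁⟩, hd₃₂⟩ := hd₃
  have e1 : e.1 ∈ verts e := by simp [verts]
  have e2 : e.2.1 ∈ verts e := by simp [verts]
  have e3 : e.2.2 ∈ verts e := by simp [verts]
  have h21 : Disjoint (blockVerts σ₂) (blockVerts σ₁) := by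
    rw [← m₂, Finset.disjoint_insert_left]
    refine ⟨?_, hd₂₁⟩
    rw [← m₁, Finset.mem_insert, not_or]
    exact ⟨n12.symm, Finset.disjoint_right.1 hd₁e e2⟩
  have h31 : Disjoint (blockVerts σ₃) (blockVerts σ₁) := by
    rw [← m₃, Finset.disjoint_insert_left]
    refine ⟨?_, hd₃₁⟩
    rw [← m₁, Finset.mem_insert, not_or]
    exact ⟨n31, Finset.disjoint_right.1 hd₁e e3⟩
  have h32 : Disjoint (blockVerts σ₃) (blockVerts σ₂) := by
    rw [← m₃, Finset.disjoint_insert_left]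
    refine ⟨?_, hd₃₂⟩
    rw [← m₂, Finset.mem_insert, not_or]
    exact ⟨n23.symm, Finset.disjoint_right.1 hd₂e e3⟩
  have hpair : ∀ i j : Fin 3, i ≠ j →
      Disjoint (blockVerts (![σ₁, σ₂, σ₃] i)) (blockVerts (![σ₁, σ₂, σ₃] j)) := by
    intro i j hij
    fin_cases i <;> fin_cases j <;>
      first
        | exact absurd rfl hij
        | exact h21
        | exact h31
        | exact h32
        | exact h21.symm
        | exact h31.symm
        | exact h32.symm
  have hbl : ∀ i : Fin 3, ![σ₁, σ₂, σ₃] i ∈ blocks G A (Fin ℓ) := by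
    intro i
    fin_cases i
    exacts [hb₁, hb₂, hb₃]
  have hsub : ∀ (σ : Fin ℓ → Fin n × Fin n × Fin n) k, verts (σ k) ⊆ blockVerts σ := fun σ k =>
    Finset.subset_biUnion_of_mem (fun k => verts (σ k)) (Finset.mem_univ k)
  refine ⟨mem_blocks.2 ⟨fun p => (mem_blocks.1 (hbl p.1)).1 p.2, ?_⟩, ?_⟩
  · rintro ⟨i, k⟩ ⟨j, l⟩ hne
    by_cases hij : i = j
    · subst hij
      exact (mem_blocks.1 (hbl i)).2 fun hkl => hne (Prod.ext rfl hkl)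
    · exact (hpair i j hij).mono (hsub _ _) (hsub _ _)
  have hunion : blockVerts (fun p : Fin 3 × Fin ℓ => ![σ₁, σ₂, σ₃] p.1 p.2) =
      blockVerts σ₁ ∪ blockVerts σ₂ ∪ blockVerts σ₃ := by
    ext v
    simp [blockVerts, Fin.exists_fin_succ]
  have hset : blockVerts (fun p : Fin 3 × Fin ℓ => ![σ₁, σ₂, σ₃] p.1 p.2) ∪ {x, y, z} =
      insert x S₁ ∪ insert y S₂ ∪ insert z S₃ ∪ verts e := by
    rw [hunion, ← m₁, ← m₂, ← m₃]
    ext v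
    simp only [verts, Finset.mem_union, Finset.mem_insert, Finset.mem_singleton]
    refine iff_of_eq ?_
    ac_rfl
  have hS₂₁ : Disjoint S₂ S₁ := hd₂₁.mono_right (Finset.erase_subset _ _)
  have hS₃₁ : Disjoint S₃ S₁ := hd₃₁.mono_right (Finset.erase_subset _ _)
  have hS₃₂ : Disjoint S₃ S₂ := hd₃₂.mono_right (Finset.erase_subset _ _)
  have tx : x ∈ ({x, y, z} : Finset (Fin n)) := by simp
  have ty : y ∈ ({x, y, z} : Finset (Fin n)) := by simp
  have tz : z ∈ ({x, y, z} : Finset (Fin n)) := by simp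
  rw [hset]
  refine ((hP₁.union hP₂ ?_).union hP₃ ?_).union (isCycTri_verts he).hasCycPM ?_
  · simp only [Finset.disjoint_insert_left, Finset.disjoint_insert_right, Finset.mem_insert,
      not_or]
    exact ⟨⟨hxy.symm, Finset.disjoint_right.1 hd₁t ty⟩, Finset.disjoint_right.1 hd₂t tx,
      hS₂₁.symm⟩
  · simp only [Finset.disjoint_insert_right, Finset.disjoint_union_left,
      Finset.disjoint_insert_left, Finset.mem_union, Finset.mem_insert, not_or]
    exact ⟨⟨⟨hxz.symm, Finset.disjoint_right.1 hd₁t tz⟩, hyz.symm,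
      Finset.disjoint_right.1 hd₂t tz⟩, ⟨Finset.disjoint_right.1 hd₃t tx, hS₃₁.symm⟩,
      Finset.disjoint_right.1 hd₃t ty, hS₃₂.symm⟩
  · simp only [Finset.disjoint_union_left, Finset.disjoint_insert_left]
    exact ⟨⟨⟨Finset.disjoint_right.1 het tx, hd₁e⟩, Finset.disjoint_right.1 het ty, hd₂e⟩,
      Finset.disjoint_right.1 het tz, hd₃e⟩

lemma card_absorbing_ge {ℓ : ℕ} [NeZero ℓ] (hG : IsOriented G) {β : ℝ} (hβ : 0 < β)
    (hlink : ∀ x y : Fin n, x ≠ y → β * (n : ℝ) ^ (3 * ℓ - 1) ≤ linkCount G ℓ x y)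
    {A t : Finset (Fin n)} (ht : t.card = 3)
    (hT : (n : ℝ) ^ 3 / 100 ≤ (cycTriples G (A \ t)).card)
    (hsmall : (Aᶜ.card : ℝ) + 6 + 6 * ℓ ≤ β / 2 * n) :
    β ^ 3 / 800 * (n : ℝ) ^ (9 * ℓ) ≤ ((blocks G A (Fin 3 × Fin ℓ)).filter
      fun τ => HasCycPM G (blockVerts τ ∪ t)).card := by
  obtain ⟨x, y, z, hxy, hxz, hyz, rfl⟩ := Finset.card_eq_three.1 ht
  set t : Finset (Fin n) := {x, y, z} with htdef
  have hℓ := NeZero.pos ℓ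
  set Q : ℝ := β / 2 * (n : ℝ) ^ (3 * ℓ - 1) with hQ
  have hQ0 : 0 ≤ Q := by positivity
  let L₁ := fun e : Fin n × Fin n × Fin n => linkBlocks G ℓ A (t ∪ verts e) x e.1
  let L₂ := fun (e : Fin n × Fin n × Fin n) (σ₁ : Fin ℓ → Fin n × Fin n × Fin n) =>
    linkBlocks G ℓ A (t ∪ verts e ∪ blockVerts σ₁) y e.2.1
  let L₃ := fun (e : Fin n × Fin n × Fin n) (σ₁ σ₂ : Fin ℓ → Fin n × Fin n × Fin n) =>
    linkBlocks G ℓ A (t ∪ verts e ∪ blockVerts σ₁ ∪ blockVerts σ₂) z e.2.2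
  set D := (cycTriples G (A \ t)).sigma fun e => (L₁ e).sigma fun σ₁ =>
    (L₂ e σ₁).sigma fun σ₂ => L₃ e σ₁ σ₂ with hD
  have hDle : D.card ≤ ((blocks G A (Fin 3 × Fin ℓ)).filter
      fun τ => HasCycPM G (blockVerts τ ∪ t)).card := by
    refine Finset.card_le_card_of_injOn
      (fun d p => ![d.2.1, d.2.2.1, d.2.2.2] p.1 p.2) ?_ ?_
    · rintro ⟨e, σ₁, σ₂, σ₃⟩ hd
      simp only [hD, Finset.coe_sigma, Set.mem_sigma_iff, Finset.mem_coe] at hd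
      exact Finset.mem_coe.2 (Finset.mem_filter.2
        (absorbing_of_linkBlocks hG hxy hxz hyz hd.1 hd.2.1 hd.2.2.1 hd.2.2.2))
    · rintro ⟨e, σ₁, σ₂, σ₃⟩ hd ⟨e', σ₁', σ₂', σ₃'⟩ hd' heq
      simp only [hD, Finset.coe_sigma, Set.mem_sigma_iff, Finset.mem_coe] at hd hd'
      obtain rfl : σ₁ = σ₁' := funext fun k => congr_fun heq (0, k)
      obtain rfl : σ₂ = σ₂' := funext fun k => congr_fun heq (1, k)
      obtain rfl : σ₃ = σ₃' := funext fun k => congr_fun heq (2, k)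
      obtain rfl : e = e' := by
        have f := fun (σ : Fin ℓ → Fin n × Fin n × Fin n) {W : Finset (Fin n)} {u v : Fin n}
          (h : σ ∈ linkBlocks G ℓ A W u v) => (Finset.mem_filter.1 h).2.1
        exact Prod.ext ((f _ hd.2.1).symm.trans (f _ hd'.2.1))
          (Prod.ext ((f _ hd.2.2.1).symm.trans (f _ hd'.2.2.1))
            ((f _ hd.2.2.2).symm.trans (f _ hd'.2.2.2)))
      rfl
  have hbv : ∀ {W : Finset (Fin n)} {u v : Fin n} {σ : Fin ℓ → Fin n × Fin n × Fin n},
      σ ∈ linkBlocks G ℓ A W u v → (blockVerts σ).card = 3 * ℓ := fun h => by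
    simpa using card_blockVerts hG (Finset.mem_filter.1 h).1
  have hcW : ∀ W : Finset (Fin n), W.card ≤ 6 + 6 * ℓ → ((Aᶜ ∪ W).card : ℝ) ≤ β / 2 * n := by
    intro W hW
    refine le_trans ?_ hsmall
    have : (Aᶜ ∪ W).card ≤ Aᶜ.card + (6 + 6 * ℓ) :=
      (Finset.card_union_le _ _).trans (Nat.add_le_add_left hW _)
    have h' : ((Aᶜ ∪ W).card : ℝ) ≤ Aᶜ.card + (6 + 6 * ℓ) := by exact_mod_cast this
    linarith
  have hDge : ((cycTriples G (A \ t)).card : ℝ) * (Q * (Q * Q)) ≤ D.card := by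
    refine card_mul_le_card_sigma _ _ fun e he => ?_
    have hte : (t ∪ verts e).card ≤ 6 :=
      (Finset.card_union_le _ _).trans (by rw [ht, card_verts hG he])
    obtain ⟨⟨ha, hb, hc⟩, -⟩ := mem_cycTriples.1 he
    rw [Finset.mem_sdiff] at ha hb hc
    have hne : ∀ {u v : Fin n}, u ∈ t → v ∉ t → u ≠ v := fun hu hv huv => hv (huv ▸ hu)
    have hL₁ : Q ≤ (L₁ e).card :=
      card_linkBlocks_ge hG ha.1 (hlink _ _ (hne (by simp [htdef]) ha.2)) (hcW _ (by omega))
    refine le_trans ?_ (card_mul_le_card_sigma _ _ (q := Q * Q) fun σ₁ hσ₁ => ?_)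
    · gcongr
    have h1 : (t ∪ verts e ∪ blockVerts σ₁).card ≤ 6 + 3 * ℓ :=
      (Finset.card_union_le _ _).trans (by rw [hbv hσ₁]; omega)
    have hL₂ : Q ≤ (L₂ e σ₁).card :=
      card_linkBlocks_ge hG hb.1 (hlink _ _ (hne (by simp [htdef]) hb.2)) (hcW _ (by omega))
    refine le_trans ?_ (card_mul_le_card_sigma _ _ (q := Q) fun σ₂ hσ₂ => ?_)
    · gcongr
    have h2 : (t ∪ verts e ∪ blockVerts σ₁ ∪ blockVerts σ₂).card ≤ 6 + 6 * ℓ :=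
      (Finset.card_union_le _ _).trans (by rw [hbv hσ₂]; omega)
    exact card_linkBlocks_ge hG hc.1 (hlink _ _ (hne (by simp [htdef]) hc.2)) (hcW _ h2)
  calc β ^ 3 / 800 * (n : ℝ) ^ (9 * ℓ) = (n : ℝ) ^ 3 / 100 * (Q * (Q * Q)) := by
        have : 9 * ℓ = 3 + (3 * ℓ - 1) + (3 * ℓ - 1) + (3 * ℓ - 1) := by omega
        rw [this, hQ, pow_add, pow_add, pow_add]; ring
    _ ≤ (cycTriples G (A \ t)).card * (Q * (Q * Q)) := by gcongr
    _ ≤ D.card := hDge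
    _ ≤ _ := by exact_mod_cast hDle

end Linking

section Iteration

variable {n : ℕ} {G : Fin n → Fin n → Prop}

lemma card_blocks_le {ι : Type} [Fintype ι] (A : Finset (Fin n)) :
    (blocks G A ι).card ≤ (cycTriples G A).card ^ Fintype.card ι := by
  refine (Finset.card_filter_le _ _).trans_eq ?_
  rw [Fintype.card_piFinset, Finset.prod_const, Finset.card_univ]

lemma SemiBalanced.sdiff {A : Finset (Fin n)} {E : ℝ} (h : SemiBalanced G A E)
    (s : Finset (Fin n)) : SemiBalanced G (A \ s) (E + s.card) := by
  intro v
  have hc : ((A \ s).card : ℝ) ≤ A.card := by exact_mod_cast Finset.card_le_card Finset.sdiff_subset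
  have key : ∀ p : Fin n → Prop, ((A.filter p).card : ℝ) ≤ ((A \ s).filter p).card + s.card := by
    intro p
    have : A.filter p ⊆ (A \ s).filter p ∪ s := fun u hu => by
      by_cases hus : u ∈ s
      · exact Finset.mem_union_right _ hus
      · rw [Finset.mem_filter] at hu
        exact Finset.mem_union_left _
          (Finset.mem_filter.2 ⟨Finset.mem_sdiff.2 ⟨hu.1, hus⟩, hu.2⟩)
    exact_mod_cast (Finset.card_le_card this).trans (Finset.card_union_le _ _)
  have h1 := key fun u => G v u
  have h2 := key fun u => G u v
  have h3 := h v
  rw [outDegOn, inDegOn] at h3 ⊢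
  constructor <;> linarith [h3.1, h3.2]

lemma card_cycTriples_sdiff_ge (hG : IsOriented G) {A s : Finset (Fin n)} {E : ℝ} (hE : 0 ≤ E)
    (hs : s.card = 3) (h : SemiBalanced G A E) (hA : (n : ℝ) / 2 + 3 ≤ A.card)
    (hEn : E + 3 ≤ n / 200) : (n : ℝ) ^ 3 / 100 ≤ (cycTriples G (A \ s)).card := by
  have h1 := h.sdiff s
  have h2 : (A.card : ℝ) ≤ (A \ s).card + 3 := by
    exact_mod_cast hs ▸ Finset.card_le_card_sdiff_add_card (s := A) (t := s)
  rw [hs] at h1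
  have h3 : (n : ℝ) / 2 ≤ (A \ s).card := by linarith
  refine le_trans ?_ (card_cycTriples_ge hG (by positivity) ?_ h1)
  · have : ((n : ℝ) / 2) ^ 3 ≤ ((A \ s).card : ℝ) ^ 3 := by gcongr
    nlinarith [pow_nonneg (Nat.cast_nonneg (α := ℝ) n) 3]
  · push_cast
    linarith

/-- Each triple is absorbed by a positive proportion of the blocks, so that halving the weights of
absorbed triples decreases the total weight on average. -/
lemma sum_absorbed_weight_le {ℓ : ℕ} [NeZero ℓ] (hG : IsOriented G) {β : ℝ} (hβ : 0 < β)
    (hlink : ∀ x y : Fin n, x ≠ y → β * (n : ℝ) ^ (3 * ℓ - 1) ≤ linkCount G ℓ x y)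
    {A : Finset (Fin n)}
    (hT : ∀ s : Finset (Fin n), s.card = 3 → (n : ℝ) ^ 3 / 100 ≤ (cycTriples G (A \ s)).card)
    (hsmall : (Aᶜ.card : ℝ) + 6 + 6 * ℓ ≤ β / 2 * n)
    {w : Finset (Fin n) → ℝ} (hw : ∀ s, 0 ≤ w s) :
    ∑ τ ∈ blocks G A (Fin 3 × Fin ℓ), ∑ s ∈ powersetCard 3 univ,
        w s * (if HasCycPM G (blockVerts τ ∪ s) then 1 / 2 else 1) ≤
      (1 - β ^ 3 / 1600) * (∑ s ∈ powersetCard 3 univ, w s) *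
        ((cycTriples G A).card : ℝ) ^ Fintype.card (Fin 3 × Fin ℓ) := by
  set M : ℝ := ((cycTriples G A).card : ℝ) ^ Fintype.card (Fin 3 × Fin ℓ) with hM
  have hblocks : ((blocks G A (Fin 3 × Fin ℓ)).card : ℝ) ≤ M := by
    rw [hM]
    exact_mod_cast card_blocks_le A
  have hMn : M ≤ (n : ℝ) ^ (9 * ℓ) := by
    have h1 : (cycTriples G A).card ≤ n ^ 3 :=
      (card_cycTriples_le A).trans (Nat.pow_le_pow_left (by simpa using Finset.card_le_univ A) 3)
    have h2 : Fintype.card (Fin 3 × Fin ℓ) = 3 * ℓ := by simp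
    rw [hM, h2, show 9 * ℓ = 3 * (3 * ℓ) by ring, pow_mul (n : ℝ) 3]
    gcongr
    exact_mod_cast h1
  rw [Finset.sum_comm, Finset.mul_sum, Finset.sum_mul]
  refine Finset.sum_le_sum fun s hs => ?_
  have hs3 := Finset.mem_powersetCard_univ.1 hs
  have habs := card_absorbing_ge hG hβ hlink hs3 (hT s hs3) hsmall
  have hsum : ∑ τ ∈ blocks G A (Fin 3 × Fin ℓ),
      (if HasCycPM G (blockVerts τ ∪ s) then 1 / 2 else 1 : ℝ) =
      (blocks G A (Fin 3 × Fin ℓ)).card - ((blocks G A (Fin 3 × Fin ℓ)).filter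
        fun τ => HasCycPM G (blockVerts τ ∪ s)).card / 2 := by
    rw [Finset.card_filter, Nat.cast_sum, Finset.sum_div, Finset.card_eq_sum_ones, Nat.cast_sum,
      ← Finset.sum_sub_distrib]
    refine Finset.sum_congr rfl fun τ _ => ?_
    split_ifs <;> norm_num
  rw [← Finset.mul_sum, hsum]
  have : β ^ 3 / 800 * M ≤ β ^ 3 / 800 * (n : ℝ) ^ (9 * ℓ) := by gcongr
  calc _ ≤ w s * (M - β ^ 3 / 800 * M / 2) := by
        refine mul_le_mul_of_nonneg_left ?_ (hw s)
        linarith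
    _ = _ := by ring

/-- A greedy choice: remove a block from `A`, controlling the potential. -/
lemma exists_block_potential_le {ℓ : ℕ} [NeZero ℓ] (hG : IsOriented G) {A : Finset (Fin n)}
    {b E E' t : ℝ} (hb : 0 < b) (hbA : b ≤ A.card) (hE : 0 ≤ E) (hEb : E ≤ b / 100)
    (hA : SemiBalanced G A E) (ht : 0 ≤ t) (ht' : t ≤ 1 / 2)
    (hsmall : Real.exp (-t ^ 2) ≤ 1 - 31 ^ (3 * ℓ) / b)
    (hEE' : E + 3 * ℓ * (120 * E / b + 4 * t) ≤ E') {F : Finset (Fin n) → ℝ} (hF0 : ∀ B, 0 ≤ F B)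
    {P : ℝ} (hP : 0 ≤ P)
    (hF : ∑ τ ∈ blocks G A (Fin 3 × Fin ℓ), F (blockVerts τ) ≤
      P * ((cycTriples G A).card : ℝ) ^ Fintype.card (Fin 3 × Fin ℓ)) :
    ∃ τ ∈ blocks G A (Fin 3 × Fin ℓ),
      Real.exp (-(t * E')) * potential G t (A \ blockVerts τ) + F (blockVerts τ) ≤
        Real.exp (-(t * E)) * potential G t A + P * Real.exp (t ^ 2) := by
  have hq : Fintype.card (Fin 3 × Fin ℓ) = 3 * ℓ := by simp
  have hpot : ∀ B, 0 ≤ potential G t B := fun B =>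
    Finset.sum_nonneg fun j _ => (Real.exp_pos _).le
  have hA0 : (0 : ℝ) < A.card := hb.trans_le hbA
  have hκ : Real.exp (-t ^ 2) ≤ 1 - 31 ^ (3 * ℓ) / (A.card : ℝ) := by
    refine hsmall.trans ?_
    gcongr
  obtain ⟨τ, hτ, h⟩ := exists_block hG (by exact_mod_cast hA0) hE
    (hEb.trans (by gcongr)) hA ht ht'
    (by rw [hq]; linarith [Real.exp_pos (-t ^ 2)]) F (Real.exp_pos (-(t * E'))).le hP hF
  refine ⟨τ, hτ, ?_⟩
  rw [hq] at h
  set L := Real.exp (-(t * E')) * potential G t (A \ blockVerts τ) + F (blockVerts τ) with hL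
  have hL0 : 0 ≤ L := add_nonneg (mul_nonneg (Real.exp_pos _).le (hpot _)) (hF0 _)
  have hexp : Real.exp (-(t * E')) *
      (potential G t A * Real.exp (t * (120 * E / A.card + 3 * t)) ^ (3 * ℓ)) ≤
      Real.exp (-(t * E)) * potential G t A * Real.exp (-t ^ 2) := by
    rw [← Real.exp_nat_mul, mul_left_comm, ← Real.exp_add, mul_comm (Real.exp (-(t * E))),
      mul_assoc, ← Real.exp_add]
    refine mul_le_mul_of_nonneg_left (Real.exp_le_exp.2 ?_) (hpot A)
    have hℓ : (1 : ℝ) ≤ 3 * ℓ := by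
      have : (1 : ℝ) ≤ ℓ := by exact_mod_cast NeZero.pos ℓ
      linarith
    have h1 : 120 * E / A.card ≤ 120 * E / b := by gcongr
    have h2 : E + 3 * ℓ * (120 * E / A.card + 3 * t) + t ≤ E' := by
      refine le_trans ?_ hEE'
      nlinarith
    push_cast
    nlinarith
  have h3 : L * Real.exp (-t ^ 2) ≤
      (Real.exp (-(t * E)) * potential G t A + P * Real.exp (t ^ 2)) * Real.exp (-t ^ 2) := by
    have h4 : P * Real.exp (t ^ 2) * Real.exp (-t ^ 2) = P := by
      rw [mul_assoc, ← Real.exp_add, add_neg_cancel, Real.exp_zero, mul_one]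
    rw [add_mul _ (P * _), h4]
    exact ((mul_le_mul_of_nonneg_left hκ hL0).trans h).trans (by gcongr)
  exact le_of_mul_le_mul_right h3 (Real.exp_pos _)

end Iteration

section Absorber

variable {n : ℕ} {G : Fin n → Fin n → Prop}

/-- The halving weight of a triple `s` after choosing the family `I` of absorbers. -/
noncomputable def absWeight (G : Fin n → Fin n → Prop) (I : Finset (Finset (Fin n)))
    (s : Finset (Fin n)) : ℝ :=
  (1 / 2) ^ (I.filter fun B => HasCycPM G (B ∪ s)).card

lemma absWeight_insert {I : Finset (Finset (Fin n))} {B : Finset (Fin n)} (hB : B ∉ I)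
    (s : Finset (Fin n)) : absWeight G (insert B I) s =
      absWeight G I s * (if HasCycPM G (B ∪ s) then 1 / 2 else 1) := by
  rw [absWeight, absWeight, Finset.filter_insert]
  split_ifs with h
  · rw [Finset.card_insert_of_notMem fun hm => hB (Finset.mem_filter.1 hm).1, pow_succ]
  · rw [mul_one]

/-- There is a family of disjoint small tiled sets such that every triple is absorbed by many of
them, and such that the semidegrees into the rest of the graph remain balanced. -/
lemma exists_absorbers {ℓ : ℕ} [NeZero ℓ] (hG : IsOriented G) {β : ℝ} (hβ : 0 < β) (hβ1 : β ≤ 1)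
    (hlink : ∀ x y : Fin n, x ≠ y → β * (n : ℝ) ^ (3 * ℓ - 1) ≤ linkCount G ℓ x y)
    {b t : ℝ} {E : ℕ → ℝ} {m : ℕ} (hb : 0 < b) (hbn : b ≤ n / 2) (ht : 0 < t) (ht' : t ≤ 1 / 2)
    (hsmall : Real.exp (-t ^ 2) ≤ 1 - 31 ^ (3 * ℓ) / b)
    (hE0 : ∀ i, 0 ≤ E i) (hE : ∀ i ≤ n, E i + 3 ≤ b / 100)
    (hEs : ∀ i, E i + 3 * ℓ * (120 * E i / b + 4 * t) ≤ E (i + 1))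
    (htβ : (1 - β ^ 3 / 1600) * Real.exp (t ^ 2) ≤ 1 - β ^ 3 / 3200)
    (hmβ : (9 * ℓ * m : ℝ) + 6 + 6 * ℓ ≤ β / 2 * n) (hmn : (9 * ℓ * m : ℝ) + 3 ≤ n / 2)
    (h0 : potential G t univ ≤ Real.exp (t * E 0) / 2) {i : ℕ} (hi : i ≤ m) :
    ∃ I : Finset (Finset (Fin n)), (∀ B ∈ I, HasCycPM G B) ∧
      (I : Set (Finset (Fin n))).PairwiseDisjoint id ∧ (I.biUnion id).card = 9 * ℓ * i ∧
      Real.exp (-(t * E i)) * potential G t (univ \ I.biUnion id) +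
        (∑ s ∈ powersetCard 3 univ, absWeight G I s) /
          (2 * (n : ℝ) ^ 3 * (1 - β ^ 3 / 3200) ^ i) ≤ 1 := by
  have hn : (0 : ℝ) < n := by linarith
  have hβ3 : β ^ 3 ≤ 1 := pow_le_one₀ hβ.le hβ1
  have hβ3' : 0 < β ^ 3 := by positivity
  have hw : ∀ I s, 0 ≤ absWeight G I s := fun I s => by rw [absWeight]; positivity
  induction i with
  | zero =>
    refine ⟨∅, by simp, by simp, by simp, ?_⟩
    have h1 : Real.exp (-(t * E 0)) * potential G t univ ≤ 1 / 2 := by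
      rw [Real.exp_neg, inv_mul_le_iff₀ (Real.exp_pos _)]
      linarith
    have h2 : ((n.choose 3 : ℕ) : ℝ) ≤ (n : ℝ) ^ 3 := by exact_mod_cast Nat.choose_le_pow n 3
    have h3 : ((n.choose 3 : ℕ) : ℝ) / (2 * (n : ℝ) ^ 3) ≤ 1 / 2 := by
      rw [div_le_iff₀ (by positivity)]
      linarith
    simpa [absWeight] using (add_le_add h1 h3).trans (by norm_num)
  | succ i ih =>
    obtain ⟨I, hI, hId, hIc, hIp⟩ := ih (by omega)
    set A := univ \ I.biUnion id with hA
    set δ : ℝ := 1 - β ^ 3 / 3200 with hδ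
    have hδ0 : 0 < δ := by linarith
    set Φ : ℝ := ∑ s ∈ powersetCard 3 univ, absWeight G I s with hΦ
    have hΦ0 : 0 ≤ Φ := Finset.sum_nonneg fun s _ => hw _ _
    have him : ((i : ℕ) : ℝ) ≤ m := by exact_mod_cast (by omega : i ≤ m)
    have hℓ : (1 : ℝ) ≤ ℓ := by exact_mod_cast NeZero.pos ℓ
    have hAc : Aᶜ.card = 9 * ℓ * i := by
      rw [hA, ← Finset.compl_eq_univ_sdiff, compl_compl, hIc]
    have hAcm : (Aᶜ.card : ℝ) ≤ 9 * ℓ * m := by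
      rw [hAc]; push_cast; gcongr
    have hAn : (A.card : ℝ) + Aᶜ.card = n := by
      exact_mod_cast (Finset.card_add_card_compl A).trans (Fintype.card_fin n)
    have hAn' : (n : ℝ) / 2 + 3 ≤ A.card := by linarith
    have hin : i ≤ n := by
      have : (i : ℝ) ≤ n := by nlinarith
      exact_mod_cast this
    have hEi := hE i hin
    have hbal : SemiBalanced G A (E i) := by
      refine semiBalanced_of_potential_le ht ?_
      have : Real.exp (-(t * E i)) * potential G t A ≤ 1 := by
        refine le_trans ?_ hIp
        exact le_add_of_nonneg_right (by positivity)
      rwa [Real.exp_neg, inv_mul_le_iff₀ (Real.exp_pos _), mul_one] at this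
    set D : ℝ := 2 * (n : ℝ) ^ 3 * δ ^ (i + 1) with hD
    have hD0 : 0 < D := by positivity
    let F : Finset (Fin n) → ℝ := fun B => (∑ s ∈ powersetCard 3 univ,
      absWeight G I s * (if HasCycPM G (B ∪ s) then 1 / 2 else 1)) / D
    obtain ⟨τ, hτ, hτp⟩ := exists_block_potential_le (ℓ := ℓ) (F := F)
      (P := (1 - β ^ 3 / 1600) * Φ / D) hG hb (by linarith) (hE0 i) (by linarith) hbal ht.le ht'
      hsmall (hEs i)
      (fun B => div_nonneg (Finset.sum_nonneg fun s _ => mul_nonneg (hw _ _)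
        (by split_ifs <;> norm_num)) hD0.le)
      (div_nonneg (mul_nonneg (by linarith) hΦ0) hD0.le) (by
        rw [← Finset.sum_div, div_mul_eq_mul_div]
        exact div_le_div_of_nonneg_right (sum_absorbed_weight_le hG hβ hlink
          (fun s hs => card_cycTriples_sdiff_ge hG (hE0 i) hs hbal hAn' (by linarith))
          (by linarith) (hw I)) hD0.le)
    have hτA := blockVerts_subset hτ
    have hd : Disjoint (I.biUnion id) (blockVerts τ) :=
      Finset.disjoint_of_subset_right hτA Finset.disjoint_sdiff
    have hτc : (blockVerts τ).card = 9 * ℓ := by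
      rw [card_blockVerts hG hτ]; simp; ring
    have hτI : blockVerts τ ∉ I := fun hm => by
      have h1 : Disjoint (blockVerts τ) (blockVerts τ) :=
        hd.mono_left (Finset.subset_biUnion_of_mem id hm)
      rw [disjoint_self, Finset.bot_eq_empty] at h1
      rw [h1, Finset.card_empty] at hτc
      have := NeZero.pos ℓ
      omega
    have hU : (insert (blockVerts τ) I).biUnion id = I.biUnion id ∪ blockVerts τ := by
      rw [Finset.biUnion_insert, Finset.union_comm, id]
    refine ⟨insert (blockVerts τ) I, ?_, ?_, ?_, ?_⟩
    · exact Finset.forall_mem_insert _ _ _ |>.2 ⟨hasCycPM_blockVerts hτ, hI⟩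
    · rw [Finset.coe_insert]
      refine hId.insert fun B hB _ => ?_
      exact (hd.mono_left (Finset.subset_biUnion_of_mem id hB)).symm
    · rw [hU, Finset.card_union_of_disjoint hd, hIc, hτc]; ring
    · have hU' : univ \ (I.biUnion id ∪ blockVerts τ) = A \ blockVerts τ := by
        ext v; simp [hA, not_or]
      rw [hU, hU', Finset.sum_congr rfl fun s _ => absWeight_insert hτI s]
      refine hτp.trans (le_trans (add_le_add le_rfl ?_) hIp)
      rw [div_mul_eq_mul_div, div_le_div_iff₀ hD0 (by positivity)]
      have h1 : (1 - β ^ 3 / 1600) * Real.exp (t ^ 2) * (Φ * (2 * (n : ℝ) ^ 3 * δ ^ i)) ≤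
          δ * (Φ * (2 * (n : ℝ) ^ 3 * δ ^ i)) := by gcongr
      calc _ = (1 - β ^ 3 / 1600) * Real.exp (t ^ 2) * (Φ * (2 * (n : ℝ) ^ 3 * δ ^ i)) := by ring
        _ ≤ _ := h1
        _ = _ := by rw [hD, pow_succ]; ring

end Absorber

section Covering

variable {n : ℕ} {G : Fin n → Fin n → Prop}

/-- A set into which the semidegrees are balanced is tiled up to fewer than `b` vertices. -/
lemma exists_almost_cover {ℓ : ℕ} [NeZero ℓ] (hG : IsOriented G) {b t : ℝ} {E : ℕ → ℝ} (hb : 0 < b)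
    (ht : 0 < t) (ht' : t ≤ 1 / 2) (hsmall : Real.exp (-t ^ 2) ≤ 1 - 31 ^ (3 * ℓ) / b)
    (hE0 : ∀ i, 0 ≤ E i) (hE : ∀ i ≤ n, E i ≤ b / 100)
    (hEs : ∀ i, E i + 3 * ℓ * (120 * E i / b + 4 * t) ≤ E (i + 1)) (k : ℕ) :
    ∀ (i : ℕ) (A : Finset (Fin n)), A.card ≤ k → i + A.card ≤ n → 3 ∣ A.card →
      Real.exp (-(t * E i)) * potential G t A ≤ 1 →
      ∃ R ⊆ A, HasCycPM G (A \ R) ∧ (R.card : ℝ) < b ∧ 3 ∣ R.card := by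
  have small : ∀ A : Finset (Fin n), (A.card : ℝ) < b → 3 ∣ A.card →
      ∃ R ⊆ A, HasCycPM G (A \ R) ∧ (R.card : ℝ) < b ∧ 3 ∣ R.card := fun A hA hA3 =>
    ⟨A, subset_rfl, by simpa using hasCycPM_empty, hA, hA3⟩
  induction k with
  | zero =>
    intro i A hA _ hA3 _
    rw [Nat.le_zero] at hA
    exact small A (by simpa [hA] using hb) hA3
  | succ k ih =>
    intro i A hA hiA hA3 hp
    rcases lt_or_ge (A.card : ℝ) b with hAb | hAb
    · exact small A hAb hA3
    have hbal : SemiBalanced G A (E i) := by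
      refine semiBalanced_of_potential_le ht ?_
      rwa [Real.exp_neg, inv_mul_le_iff₀ (Real.exp_pos _), mul_one] at hp
    obtain ⟨τ, hτ, hτp⟩ := exists_block_potential_le (ℓ := ℓ) (F := 0) (P := 0) hG hb hAb (hE0 i)
      (hE i (by omega)) hbal ht.le ht' hsmall (hEs i) (fun _ => le_rfl) le_rfl (by simp)
    have hτA := blockVerts_subset hτ
    have hτc : (blockVerts τ).card = 9 * ℓ := by
      rw [card_blockVerts hG hτ]; simp; ring
    have hc := Finset.card_sdiff_add_card_eq_card hτA
    have hℓ := NeZero.pos ℓ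
    obtain ⟨R, hR, hRp, hRb, hR3⟩ := ih (i + 1) (A \ blockVerts τ) (by omega) (by omega) (by omega)
      (by simpa using hτp.trans (by simpa using hp))
    refine ⟨R, hR.trans Finset.sdiff_subset, ?_, hRb, hR3⟩
    have hd : Disjoint ((A \ blockVerts τ) \ R) (blockVerts τ) :=
      Finset.disjoint_of_subset_left Finset.sdiff_subset Finset.sdiff_disjoint
    convert hRp.union (hasCycPM_blockVerts hτ) hd using 1
    ext v
    have h1 : v ∈ blockVerts τ → v ∈ A := fun h => hτA h
    have h2 : v ∈ R → v ∉ blockVerts τ := fun h => (Finset.mem_sdiff.1 (hR h)).2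
    simp only [Finset.mem_sdiff, Finset.mem_union]
    grind

lemma exists_isCycFactor {ℓ : ℕ} [NeZero ℓ] (hG : IsOriented G) (hn3 : 3 ∣ n) {β : ℝ} (hβ : 0 < β)
    (hβ1 : β ≤ 1)
    (hlink : ∀ x y : Fin n, x ≠ y → β * (n : ℝ) ^ (3 * ℓ - 1) ≤ linkCount G ℓ x y)
    {b t : ℝ} {E : ℕ → ℝ} {m : ℕ} (hb : 0 < b) (hbn : b ≤ n / 2) (ht : 0 < t) (ht' : t ≤ 1 / 2)
    (hsmall : Real.exp (-t ^ 2) ≤ 1 - 31 ^ (3 * ℓ) / b)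
    (hE0 : ∀ i, 0 ≤ E i) (hE : ∀ i ≤ n, E i + 3 ≤ b / 100)
    (hEs : ∀ i, E i + 3 * ℓ * (120 * E i / b + 4 * t) ≤ E (i + 1))
    (htβ : (1 - β ^ 3 / 1600) * Real.exp (t ^ 2) ≤ 1 - β ^ 3 / 3200)
    (hmβ : (9 * ℓ * m : ℝ) + 6 + 6 * ℓ ≤ β / 2 * n) (hmn : (9 * ℓ * m : ℝ) + 3 ≤ n / 2)
    (h0 : potential G t univ ≤ Real.exp (t * E 0) / 2)
    (hm : 2 * (n : ℝ) ^ 3 * (1 - β ^ 3 / 3200) ^ m ≤ Real.exp (-b)) :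
    ∃ C : Finset (Finset (Fin n)), IsCycFactor G C := by
  obtain ⟨I, hI, hId, hIc, hIp⟩ := exists_absorbers hG hβ hβ1 hlink hb hbn ht ht' hsmall hE0 hE hEs
    htβ hmβ hmn h0 le_rfl
  have hn : (0 : ℝ) < n := by linarith
  have hβ3 : β ^ 3 ≤ 1 := pow_le_one₀ hβ.le hβ1
  have hβ3' : 0 < β ^ 3 := by positivity
  have hδ : 0 < 1 - β ^ 3 / 3200 := by linarith
  have hw : ∀ s, 0 ≤ absWeight G I s := fun s => by rw [absWeight]; positivity
  have hpot : 0 ≤ potential G t (univ \ I.biUnion id) :=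
    Finset.sum_nonneg fun j _ => (Real.exp_pos _).le
  set D : ℝ := 2 * (n : ℝ) ^ 3 * (1 - β ^ 3 / 3200) ^ m with hD
  have hD0 : 0 < D := by positivity
  have hΦ0 : 0 ≤ ∑ s ∈ powersetCard 3 univ, absWeight G I s := Finset.sum_nonneg fun s _ => hw s
  have hΦ : ∑ s ∈ powersetCard 3 univ, absWeight G I s ≤ D := by
    have : (∑ s ∈ powersetCard 3 univ, absWeight G I s) / D ≤ 1 :=
      le_trans (le_add_of_nonneg_left (by positivity)) hIp
    rwa [div_le_one hD0] at this
  have hAc : (univ \ I.biUnion id).card + 9 * ℓ * m = n := by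
    rw [← hIc, Finset.card_sdiff_add_card_eq_card (Finset.subset_univ _), Finset.card_univ,
      Fintype.card_fin]
  have hℓ := NeZero.pos ℓ
  have hℓm : m ≤ 9 * ℓ * m := Nat.le_mul_of_pos_left m (by omega)
  obtain ⟨R, hR, hRp, hRb, r, hr⟩ := exists_almost_cover hG hb ht ht' hsmall hE0
    (fun i hi => by linarith [hE i hi]) hEs n m (univ \ I.biUnion id) (by omega) (by omega)
    (by
      have h1 : 3 ∣ 9 * ℓ * m := ⟨3 * ℓ * m, by ring⟩
      exact (Nat.dvd_add_left h1).1 (hAc.symm ▸ hn3))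
    (le_trans (le_add_of_nonneg_right (div_nonneg hΦ0 hD0.le)) hIp)
  have hRI : ∀ B ∈ I, Disjoint R B := fun B hB =>
    Finset.disjoint_of_subset_left hR
      (Finset.sdiff_disjoint.mono_right (Finset.subset_biUnion_of_mem id hB))
  have habs := hasCycPM_union_of_absorbing r R I hr hI hId hRI fun s _ hs => by
    by_contra! hlt
    have h1 : absWeight G I s ≤ Real.exp (-b) :=
      (Finset.single_le_sum (fun s _ => hw s) (Finset.mem_powersetCard_univ.2 hs)).trans
        (hΦ.trans hm)
    have h2 : Real.exp (-b) < (1 / 2 : ℝ) ^ r := by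
      have hrb : (r : ℝ) < b := by
        refine lt_of_le_of_lt ?_ hRb
        exact_mod_cast (by omega : r ≤ R.card)
      have h3 : Real.exp (-1) ≤ 1 / 2 := by
        rw [Real.exp_neg, one_div]
        exact inv_anti₀ two_pos (by linarith [Real.add_one_le_exp 1])
      calc Real.exp (-b) < Real.exp (r * (-1)) := Real.exp_lt_exp.2 (by linarith)
        _ = Real.exp (-1) ^ r := Real.exp_nat_mul _ _
        _ ≤ _ := by gcongr
    have h4 : (1 / 2 : ℝ) ^ r ≤ absWeight G I s :=
      pow_le_pow_of_le_one (by norm_num) (by norm_num) hlt.le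
    linarith
  have hd : Disjoint ((univ \ I.biUnion id) \ R) (R ∪ I.biUnion id) := by
    rw [Finset.disjoint_union_right]
    exact ⟨Finset.sdiff_disjoint,
      Finset.disjoint_of_subset_left Finset.sdiff_subset Finset.sdiff_disjoint⟩
  have hfin := hRp.union habs hd
  have huniv : (univ \ I.biUnion id) \ R ∪ (R ∪ I.biUnion id) = univ := by
    ext v
    simp only [Finset.mem_union, Finset.mem_sdiff, Finset.mem_univ, true_and, iff_true]
    tauto
  rwa [huniv] at hfin

lemma potential_univ_le {c t : ℝ} (ht : 0 ≤ t) (h : MinSemidegreeGE G ((1 / 2 - c) * n)) :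
    potential G t univ ≤ 2 * n * Real.exp (t * (c * n)) := by
  have hj : ∀ j, Real.exp (t * dev (nbr G j) univ) ≤ Real.exp (t * (c * n)) := by
    rintro ⟨v, _ | _⟩ <;> refine Real.exp_le_exp.2 (mul_le_mul_of_nonneg_left ?_ ht)
    · rw [dev_nbr_false, Finset.card_univ, Fintype.card_fin]
      have := (h v).2
      rw [inDeg] at this
      linarith
    · rw [dev_nbr_true, Finset.card_univ, Fintype.card_fin]
      have := (h v).1
      rw [outDeg] at this
      linarith
  refine (Finset.sum_le_card_nsmul _ _ _ fun j _ => hj j).trans_eq ?_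
  simp [mul_comm]

end Covering

/-- The recursively accumulated semidegree error stays below `η * n * exp K`. -/
lemma error_growth {K η x : ℝ} (hK : 0 ≤ K) (hη : 0 ≤ η) (hx : 0 < x) {i : ℕ} (hi : (i : ℝ) ≤ x) :
    η * x * (1 + K / x) ^ i ≤ η * x * Real.exp K := by
  have h1 : (1 + K / x) ^ i ≤ Real.exp (K / x) ^ i := by
    gcongr
    linarith [Real.add_one_le_exp (K / x)]
  rw [← Real.exp_nat_mul] at h1
  have h2 : (i : ℝ) * (K / x) ≤ K := by
    rw [← mul_div_assoc, div_le_iff₀ hx, mul_comm]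
    gcongr
  gcongr
  exact h1.trans (Real.exp_le_exp.2 h2)

lemma error_step {ℓ : ℕ} {γ η x K : ℝ} (hγ : 0 < γ) (hη : 0 ≤ η) (hx : 0 < x)
    (hK : K = 3 * ℓ * (120 / γ + 4)) {i : ℕ} :
    η * x * (1 + K / x) ^ i +
      3 * ℓ * (120 * (η * x * (1 + K / x) ^ i) / (γ * x) + 4 * η) ≤
      η * x * (1 + K / x) ^ (i + 1) := by
  have hK0 : 0 ≤ K := by rw [hK]; positivity
  have h1 : (1 : ℝ) ≤ (1 + K / x) ^ i := one_le_pow₀ (by linarith [div_nonneg hK0 hx.le])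
  rw [pow_succ]
  set y : ℝ := (1 + K / x) ^ i
  have h2 : η * x * (y * (1 + K / x)) = η * x * y + K * η * y := by field_simp
  have h3 : 120 * (η * x * y) / (γ * x) = 120 / γ * η * y := by field_simp
  rw [h2, h3, hK]
  have h4 : 3 * ℓ * (4 * η) ≤ 3 * ℓ * (4 * η) * y := le_mul_of_one_le_right (by positivity) h1
  linarith

lemma one_sub_pow_le {δ x : ℝ} {m : ℕ} (hδ : δ ≤ 1) (hx : x ≤ δ * m) :
    (1 - δ) ^ m ≤ Real.exp (-x) := by
  calc (1 - δ) ^ m ≤ Real.exp (-δ) ^ m :=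
        pow_le_pow_left₀ (by linarith) (Real.one_sub_le_exp_neg δ) m
    _ = Real.exp (m * -δ) := (Real.exp_nat_mul _ _).symm
    _ ≤ _ := Real.exp_le_exp.2 (by linarith)

lemma potential_univ_le_exp {n : ℕ} {G : Fin n → Fin n → Prop} {c t : ℝ} (ht : 0 ≤ t)
    (hc : c ≤ t / 2) (hn : 4 * (n : ℝ) ≤ Real.exp (t ^ 2 / 2 * n))
    (h : MinSemidegreeGE G ((1 / 2 - c) * n)) :
    potential G t univ ≤ Real.exp (t * (t * n)) / 2 := by
  refine (potential_univ_le ht h).trans ?_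
  have h1 : Real.exp (t * (c * n)) ≤ Real.exp (t ^ 2 / 2 * n) := by
    refine Real.exp_le_exp.2 ?_
    calc t * (c * n) ≤ t * (t / 2 * n) := by gcongr
      _ = _ := by ring
  have h2 : Real.exp (t * (t * n)) = Real.exp (t ^ 2 / 2 * n) * Real.exp (t ^ 2 / 2 * n) := by
    rw [← Real.exp_add]; congr 1; ring
  have h3 : 4 * n * Real.exp (t * (c * n)) ≤
      Real.exp (t ^ 2 / 2 * n) * Real.exp (t ^ 2 / 2 * n) := by gcongr
  linarith

lemma one_sub_mul_exp_sq_le {p t : ℝ} (hp : p ≤ 1) (ht : t ^ 2 ≤ p / 4) :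
    (1 - p / 2) * Real.exp (t ^ 2) ≤ 1 - p / 4 := by
  have h1 : Real.exp (t ^ 2) ≤ Real.exp (p / 4) := Real.exp_le_exp.2 ht
  have h2 : (1 - p / 4) * Real.exp (p / 4) ≤ 1 := by
    have := mul_le_mul_of_nonneg_right (Real.one_sub_le_exp_neg (p / 4)) (Real.exp_pos (p / 4)).le
    rwa [← Real.exp_add, neg_add_cancel, Real.exp_zero] at this
  nlinarith [Real.exp_pos (t ^ 2), Real.exp_pos (p / 4), sq_nonneg p]

lemma eventually_pow_le_exp (a : ℝ) (k : ℕ) {δ : ℝ} (hδ : 0 < δ) :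
    ∀ᶠ n : ℕ in Filter.atTop, a * (n : ℝ) ^ k ≤ Real.exp (δ * n) := by
  have h := (isLittleO_pow_exp_pos_mul_atTop k hδ).const_mul_left a
  filter_upwards [tendsto_natCast_atTop_atTop.eventually (h.bound one_pos)] with n hn
  rw [one_mul, Real.norm_of_nonneg (Real.exp_pos _).le] at hn
  exact (le_abs_self _).trans hn

lemma eventually_le_mul_natCast (a : ℝ) {δ : ℝ} (hδ : 0 < δ) :
    ∀ᶠ n : ℕ in Filter.atTop, a ≤ δ * (n : ℝ) :=
  (tendsto_natCast_atTop_atTop.const_mul_atTop hδ).eventually_ge_atTop a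

theorem stmt_14 :
    ∀ ℓ : ℕ, 1 ≤ ℓ →
    ∃ β₀ > (0:ℝ), ∀ β : ℝ, 0 < β → β ≤ β₀ →
    ∃ c₀ > (0:ℝ), ∀ c : ℝ, 0 < c → c ≤ c₀ →
    ∃ N : ℕ, ∀ n : ℕ, N ≤ n → 3 ∣ n → ∀ G : Fin n → Fin n → Prop, IsOriented G →
      MinSemidegreeGE G ((1/2 - c) * n) →
      (∀ x y : Fin n, x ≠ y → β * (n : ℝ)^(3 * ℓ - 1) ≤ (linkCount G ℓ x y : ℝ)) →
      ∃ C : Finset (Finset (Fin n)), IsCycFactor G C := by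
  intro ℓ hℓ
  have : NeZero ℓ := ⟨by omega⟩
  have hℓ' : (1 : ℝ) ≤ ℓ := by exact_mod_cast hℓ
  refine ⟨1, one_pos, fun β hβ hβ1 => ?_⟩
  have hβ3 : β ^ 3 ≤ 1 := pow_le_one₀ hβ.le hβ1
  have hβ3' : 0 < β ^ 3 := by positivity
  set p : ℝ := β ^ 3 / 800 with hp
  have hp0 : 0 < p := by positivity
  have hp1 : p ≤ 1 / 800 := by rw [hp]; linarith
  set α : ℝ := β / (36 * ℓ) with hα
  have hα0 : 0 < α := by positivity
  have hα1 : α ≤ 1 := by rw [hα, div_le_one (by positivity)]; linarith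
  have hαℓ : 9 * ℓ * α = β / 4 := by rw [hα]; field_simp; norm_num
  set γ : ℝ := p * α / 8 with hγ
  have hγ0 : 0 < γ := by positivity
  have hγ1 : γ ≤ 1 / 2 := by
    rw [hγ]; linarith [mul_le_of_le_one_right hp0.le hα1]
  set K : ℝ := 3 * ℓ * (120 / γ + 4) with hK
  have hK0 : 0 ≤ K := by positivity
  set η : ℝ := min (γ * Real.exp (-K) / 200) (p / 4) with hη
  have hη0 : 0 < η := lt_min (by positivity) (by positivity)
  have hηp : η ≤ p / 4 := min_le_right _ _
  have hηK : η * Real.exp K ≤ γ / 200 := by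
    calc η * Real.exp K ≤ γ * Real.exp (-K) / 200 * Real.exp K := by
          gcongr; exact min_le_left _ _
      _ = γ * (Real.exp (-K) * Real.exp K) / 200 := by ring
      _ = γ / 200 := by rw [← Real.exp_add, neg_add_cancel, Real.exp_zero, mul_one]
  have hexpη : Real.exp (-η ^ 2) < 1 := by
    rw [Real.exp_lt_one_iff]
    linarith [pow_pos hη0 2]
  refine ⟨η / 2, by positivity, fun c hc hcη => ?_⟩
  have hev := (eventually_pow_le_exp 4 1 (δ := η ^ 2 / 2) (by positivity)).and <|
    (eventually_pow_le_exp 2 3 (δ := p * α / 8) (by positivity)).and <|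
    (eventually_le_mul_natCast 600 (δ := γ) hγ0).and <|
    (eventually_le_mul_natCast (15 * ℓ + 6) (δ := β / 4) (by positivity)).and <|
    eventually_le_mul_natCast (31 ^ (3 * ℓ)) (δ := (1 - Real.exp (-η ^ 2)) * γ)
      (mul_pos (by linarith) hγ0)
  obtain ⟨N, hN⟩ := Filter.eventually_atTop.1 hev
  refine ⟨N, fun n hn hn3 G hG hdeg hlink => ?_⟩
  obtain ⟨h4n, h2n, h600, hβn, h31⟩ := hN n hn
  have hγn : 0 < γ * n := by linarith
  have hn0 : (0 : ℝ) < n := (pos_iff_pos_of_mul_pos hγn).1 hγ0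
  set m := ⌈α * n⌉₊ with hm
  have hm1 : α * n ≤ m := Nat.le_ceil _
  have hm2 : (m : ℝ) ≤ α * n + 1 := (Nat.ceil_lt_add_one (by positivity)).le
  have hmℓ : (9 * ℓ * m : ℝ) ≤ β / 4 * n + 9 * ℓ := by
    calc (9 * ℓ * m : ℝ) ≤ 9 * ℓ * (α * n + 1) := by gcongr
      _ = 9 * ℓ * α * n + 9 * ℓ := by ring
      _ = _ := by rw [hαℓ]
  have hβn' : β * n ≤ n := mul_le_of_le_one_left hn0.le hβ1
  refine exists_isCycFactor (b := γ * n) (t := η) (m := m)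
    (E := fun i => η * n * (1 + K / n) ^ i) hG hn3 hβ hβ1 hlink hγn ?_ hη0 (by linarith) ?_
    (fun i => by positivity) (fun i hi => ?_) (fun i => ?_) ?_ ?_ ?_ ?_ ?_
  · linarith [mul_le_mul_of_nonneg_right hγ1 hn0.le]
  · have : (31 : ℝ) ^ (3 * ℓ) / (γ * n) ≤ 1 - Real.exp (-η ^ 2) := by
      rw [div_le_iff₀ hγn]; linarith
    linarith
  · have := error_growth hK0 hη0.le hn0 (i := i) (by exact_mod_cast hi)
    linarith [mul_le_mul_of_nonneg_right hηK hn0.le]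
  · exact error_step hγ0 hη0.le hn0 hK
  · have := one_sub_mul_exp_sq_le (p := p) (t := η) (by linarith)
      (by rw [sq]; exact (mul_le_of_le_one_left hη0.le (by linarith)).trans hηp)
    rwa [show p / 2 = β ^ 3 / 1600 by rw [hp]; ring,
      show p / 4 = β ^ 3 / 3200 by rw [hp]; ring] at this
  · linarith
  · linarith
  · rw [pow_one] at h4n
    rw [pow_zero, mul_one]
    exact potential_univ_le_exp hη0.le hcη h4n hdeg
  · have h1 : (1 - β ^ 3 / 3200) ^ m ≤ Real.exp (-(p * α / 4 * n)) := by
      refine one_sub_pow_le (by linarith) ?_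
      calc p * α / 4 * n = β ^ 3 / 3200 * (α * n) := by rw [hp]; ring
        _ ≤ _ := by gcongr
    have h0 : 0 ≤ (1 - β ^ 3 / 3200) ^ m := pow_nonneg (by linarith) _
    calc 2 * (n : ℝ) ^ 3 * (1 - β ^ 3 / 3200) ^ m
        ≤ Real.exp (p * α / 8 * n) * Real.exp (-(p * α / 4 * n)) := by gcongr
      _ = Real.exp (-(γ * n)) := by
          rw [← Real.exp_add, hγ]; congr 1; ring
end

section
/- Suppose 0 < 1/n ≪ c ≪ μ ≪ α ≪ η < 1 and G is an oriented graph on n vertices with δ⁰(G) ≥ (1/2 - c)n. Let P = {V₁, ..., V_d} be a partition of V(G) with d ≥ 2 and |Vᵢ| ≥ ηn for all i. If the lattice generated by the μ-robust edge-vectors of H(G) with respect to P contains no difference u_i - u_j of unit vectors (i.e., is 2-transferral-free), then there exists a part A ∈ P such that cyc(A, A, Ā) ≤ αn³. -/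
open Finset
open scoped Classical

/-- The `0/1` adjacency matrix `g` of an oriented graph all of whose in- and outdegrees are at
least `(1/2 - c)|V|`. -/
structure IsNearRegular {V : Type*} [Fintype V] (g : V → V → ℝ) (c : ℝ) : Prop where
  zero_or_one : ∀ u v, g u v = 0 ∨ g u v = 1
  add_le_one : ∀ u v, g u v + g v u ≤ 1
  le_out : ∀ u, (1 / 2 - c) * Fintype.card V ≤ ∑ v, g u v
  le_in : ∀ u, (1 / 2 - c) * Fintype.card V ≤ ∑ v, g v u

namespace IsNearRegular

variable {V : Type*} [Fintype V] {g : V → V → ℝ} {c : ℝ}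

theorem transpose (h : IsNearRegular g c) : IsNearRegular (fun u v => g v u) c :=
  ⟨fun u v => h.zero_or_one v u, fun u v => h.add_le_one v u, h.le_in, h.le_out⟩

theorem nonneg (h : IsNearRegular g c) (u v : V) : 0 ≤ g u v := by
  rcases h.zero_or_one u v with h | h <;> simp [h]

theorem le_one (h : IsNearRegular g c) (u v : V) : g u v ≤ 1 := by
  rcases h.zero_or_one u v with h | h <;> simp [h]

theorem sum_le_card (h : IsNearRegular g c) (u : V) (S : Finset V) :
    ∑ w ∈ S, g u w ≤ S.card := by
  simpa using sum_le_sum fun w (_ : w ∈ S) => h.le_one u w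

theorem sum_nonadj_le (h : IsNearRegular g c) (u : V) (S : Finset V) :
    ∑ w ∈ S, (1 - g u w - g w u) ≤ 2 * c * Fintype.card V := by
  have h1 : ∑ w ∈ S, (1 - g u w - g w u) ≤ ∑ w, (1 - g u w - g w u) :=
    sum_le_sum_of_subset_of_nonneg (subset_univ S) fun w _ _ => by
      linarith [h.add_le_one u w]
  simp only [sum_sub_distrib, sum_const, card_univ, nsmul_eq_mul, mul_one] at h1 ⊢
  linarith [h.le_out u, h.le_in u]

theorem sum_univ_sub_le (h : IsNearRegular g c) (x y : V) :
    ∑ w, g x w - ∑ w, g y w ≤ 2 * c * Fintype.card V := by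
  have h1 : ∑ w, (g x w + g w x) ≤ Fintype.card V := by
    simpa using sum_le_sum fun w (_ : w ∈ (univ : Finset V)) => h.add_le_one x w
  rw [sum_add_distrib] at h1
  linarith [h.le_in x, h.le_out y]

theorem outdeg_sub_ge [DecidableEq V] (h : IsNearRegular g c) (x y : V) (Y : Finset V) :
    ∑ w ∈ Yᶜ, g x w * g w y - ∑ w ∈ Yᶜ, g y w * g w x - 4 * c * Fintype.card V
      ≤ ∑ w ∈ Y, g y w - ∑ w ∈ Y, g x w := by
  have h1 : ∑ w ∈ Yᶜ, g x w * g w y ≤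
      ∑ w ∈ Yᶜ, (g x w - g y w + g y w * g w x + (1 - g x w - g w x)) := by
    refine sum_le_sum fun w _ => ?_
    have a1 := h.add_le_one x w
    have a2 := h.add_le_one y w
    rcases h.zero_or_one x w with e1 | e1 <;> rcases h.zero_or_one w x with e2 | e2 <;>
    rcases h.zero_or_one y w with e3 | e3 <;> rcases h.zero_or_one w y with e4 | e4 <;>
    rw [e1, e2] at a1 <;> rw [e3, e4] at a2 <;> rw [e1, e2, e3, e4] <;> linarith
  have h2 := h.sum_nonadj_le x Yᶜ
  rw [sum_add_distrib, sum_add_distrib, sum_sub_distrib] at h1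
  have h3 := h.sum_univ_sub_le x y
  have hx := sum_add_sum_compl Y (g x)
  have hy := sum_add_sum_compl Y (g y)
  linarith

theorem indeg_sub_le (h : IsNearRegular g c) (x y : V) (X : Finset V) :
    ∑ w ∈ X, g w y - ∑ w ∈ X, g w x
      ≤ ∑ w ∈ X, g x w * g w y + 2 * c * Fintype.card V := by
  have h1 : ∑ w ∈ X, (g w y - g w x) ≤
      ∑ w ∈ X, (g x w * g w y + (1 - g x w - g w x)) := by
    refine sum_le_sum fun w _ => ?_
    have a1 := h.add_le_one x w
    rcases h.zero_or_one x w with e1 | e1 <;> rcases h.zero_or_one w x with e2 | e2 <;>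
    rcases h.zero_or_one w y with e4 | e4 <;>
    rw [e1, e2] at a1 <;> rw [e1, e2, e4] <;> linarith
  have h2 := h.sum_nonadj_le x X
  rw [sum_add_distrib, sum_sub_distrib] at h1
  linarith

/-- The number of two-edge paths ending at `a` inside `X`, in terms of the indegree of `a`. -/
theorem sum_indeg_le (h : IsNearRegular g c) (a : V) (X : Finset V) :
    ∑ x ∈ X, g x a * ∑ w ∈ X, g w x ≤
      (∑ x ∈ X, g x a) ^ 2 / 2 + ∑ x ∈ X, ∑ w ∈ X, g x a * g a w * g w x
        + 2 * c * Fintype.card V * ∑ x ∈ X, g x a := by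
  have h1 : ∑ x ∈ X, g x a * ∑ w ∈ X, g w x ≤
      ∑ x ∈ X, ∑ w ∈ X, (g x a * g w a * g w x) + ∑ x ∈ X, ∑ w ∈ X, g x a * g a w * g w x
        + ∑ x ∈ X, g x a * ∑ w ∈ X, (1 - g a w - g w a) := by
    simp only [mul_sum, ← sum_add_distrib]
    refine sum_le_sum fun x _ => sum_le_sum fun w _ => ?_
    have a1 := h.add_le_one a w
    rcases h.zero_or_one x a with e1 | e1 <;> rcases h.zero_or_one w x with e2 | e2 <;>
    rcases h.zero_or_one a w with e3 | e3 <;> rcases h.zero_or_one w a with e4 | e4 <;>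
    rw [e3, e4] at a1 <;> rw [e1, e2, e3, e4] <;> linarith
  have h2 : ∑ x ∈ X, g x a * ∑ w ∈ X, (1 - g a w - g w a) ≤
      2 * c * Fintype.card V * ∑ x ∈ X, g x a := by
    rw [mul_comm, sum_mul]
    exact sum_le_sum fun x _ => mul_le_mul_of_nonneg_left (h.sum_nonadj_le a X) (h.nonneg x a)
  have h3 : ∑ x ∈ X, ∑ w ∈ X, (g x a * g w a * g w x) =
      ∑ x ∈ X, ∑ w ∈ X, (g x a * g w a * g x w) := by
    rw [sum_comm]
    exact sum_congr rfl fun x _ => sum_congr rfl fun w _ => by ring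
  have h4 : ∑ x ∈ X, ∑ w ∈ X, (g x a * g w a * g w x) + ∑ x ∈ X, ∑ w ∈ X, (g x a * g w a * g x w)
      ≤ (∑ x ∈ X, g x a) ^ 2 := by
    rw [sq, sum_mul_sum]
    simp only [← sum_add_distrib]
    refine sum_le_sum fun x _ => sum_le_sum fun w _ => ?_
    have a1 := h.add_le_one x w
    nlinarith [mul_nonneg (h.nonneg x a) (h.nonneg w a)]
  linarith

/-- The number of two-edge paths inside `X`. -/
theorem sum_paths_ge (h : IsNearRegular g c) (hc : 0 ≤ c) (X : Finset V) :
    (X.card : ℝ) ^ 3 / 6 - c * (Fintype.card V : ℝ) ^ 3 ≤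
      ∑ x ∈ X, (∑ w ∈ X, g x w) * ∑ w ∈ X, g w x := by
  set N : ℝ := (Fintype.card V : ℝ)
  set P := ∑ x ∈ X, (∑ w ∈ X, g x w) * ∑ w ∈ X, g w x with hP
  have hXN : (X.card : ℝ) ≤ N := Nat.cast_le.2 X.card_le_univ
  have hP' : P = ∑ v ∈ X, ∑ u ∈ X, ∑ w ∈ X, g u v * g v w := by
    rw [hP]
    refine sum_congr rfl fun v _ => ?_
    rw [mul_comm, sum_mul_sum]
  have p1 : ∑ u ∈ X, ∑ v ∈ X, ∑ w ∈ X, g u v * g v w = P := by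
    rw [hP', sum_comm]
  have p2 : ∑ u ∈ X, ∑ v ∈ X, ∑ w ∈ X, g w v * g v u = P := by
    rw [hP', sum_comm]
    exact sum_congr rfl fun v _ => sum_comm
  have p3 : ∑ u ∈ X, ∑ v ∈ X, ∑ w ∈ X, g v u * g u w = P := hP'.symm
  have p4 : ∑ u ∈ X, ∑ v ∈ X, ∑ w ∈ X, g w u * g u v = P := by
    rw [hP']
    exact sum_congr rfl fun v _ => sum_comm
  have p5 : ∑ u ∈ X, ∑ v ∈ X, ∑ w ∈ X, g u w * g w v = P := by
    rw [← p1]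
    exact sum_congr rfl fun v _ => sum_comm
  have p6 : ∑ u ∈ X, ∑ v ∈ X, ∑ w ∈ X, g v w * g w u = P := by
    rw [← p2]
    exact sum_congr rfl fun v _ => sum_comm
  have n1 : ∑ u ∈ X, ∑ v ∈ X, ∑ _w ∈ X, (1 - g u v - g v u) ≤ 2 * c * N ^ 3 := by
    have : ∀ u ∈ X, ∑ v ∈ X, ∑ _w ∈ X, (1 - g u v - g v u) ≤ N * (2 * c * N) := by
      intro u _
      simp only [sum_const, nsmul_eq_mul, ← mul_sum]
      have := h.sum_nonadj_le u X
      have h0 : 0 ≤ ∑ v ∈ X, (1 - g u v - g v u) :=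
        sum_nonneg fun v _ => by linarith [h.add_le_one u v]
      gcongr
    have := sum_le_sum this
    simp only [sum_const, nsmul_eq_mul] at this ⊢
    have h2 : (X.card : ℝ) * (N * (2 * c * N)) ≤ N * (N * (2 * c * N)) := by gcongr
    calc _ ≤ _ := this
      _ ≤ _ := h2
      _ = _ := by ring
  have n2 : ∑ u ∈ X, ∑ v ∈ X, ∑ w ∈ X, (1 - g u w - g w u) ≤ 2 * c * N ^ 3 := by
    refine le_of_eq_of_le (sum_congr rfl fun v _ => sum_comm) n1
  have n3 : ∑ u ∈ X, ∑ v ∈ X, ∑ w ∈ X, (1 - g v w - g w v) ≤ 2 * c * N ^ 3 := by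
    refine le_of_eq_of_le ?_ n1
    rw [sum_comm]
    simp only [sum_const, ← smul_sum]
  have key : ∑ u ∈ X, ∑ v ∈ X, ∑ w ∈ X, (1 : ℝ) ≤ ∑ u ∈ X, ∑ v ∈ X, ∑ w ∈ X,
      (g u v * g v w + g w v * g v u + g v u * g u w + g w u * g u v + g u w * g w v
        + g v w * g w u + (1 - g u v - g v u) + (1 - g u w - g w u) + (1 - g v w - g w v)) := by
    refine sum_le_sum fun u _ => sum_le_sum fun v _ => sum_le_sum fun w _ => ?_
    have a1 := h.add_le_one u v
    have a2 := h.add_le_one u w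
    have a3 := h.add_le_one v w
    rcases h.zero_or_one u v with e1 | e1 <;> rcases h.zero_or_one v u with e2 | e2 <;>
    rcases h.zero_or_one u w with e3 | e3 <;> rcases h.zero_or_one w u with e4 | e4 <;>
    rcases h.zero_or_one v w with e5 | e5 <;> rcases h.zero_or_one w v with e6 | e6 <;>
    rw [e1, e2] at a1 <;> rw [e3, e4] at a2 <;> rw [e5, e6] at a3 <;>
    rw [e1, e2, e3, e4, e5, e6] <;> linarith
  simp only [sum_add_distrib] at key
  rw [p1, p2, p3, p4, p5, p6] at key
  have hc3 : ∑ u ∈ X, ∑ v ∈ X, ∑ w ∈ X, (1 : ℝ) = (X.card : ℝ) ^ 3 := by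
    simp; ring
  rw [hc3] at key
  linarith

/-- If few cyclic triangles have an edge inside `X` and the third vertex outside `Y`, then for
typical `x ∈ X` the outdegree of `x` into `Y` is not much less than its indegree from `X`. -/
theorem exists_typical [DecidableEq V] (h : IsNearRegular g c) (hN : 0 < Fintype.card V)
    {X Y : Finset V} (hXY : Disjoint X Y) {τ δ : ℝ} (hcτ : c ≤ τ) (hτ : 0 < τ)
    (hδ : 0 ≤ δ) (hδτ : δ ^ 2 = 80 * τ)
    (hcyc : ∑ x ∈ X, ∑ x' ∈ X, ∑ w ∈ Yᶜ, g x' x * g x w * g w x'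
      ≤ τ ^ 2 * (Fintype.card V : ℝ) ^ 3) :
    ∃ T ⊆ X, ((X \ T).card : ℝ) ≤ τ * Fintype.card V ∧
      ∀ x ∈ T, 3 / 4 * ∑ w ∈ X, g w x ≤ ∑ w ∈ Y, g x w + δ * Fintype.card V := by
  set N : ℝ := (Fintype.card V : ℝ)
  have hN' : 0 < N := Nat.cast_pos.2 hN
  set σ : V → ℝ := fun x => ∑ x' ∈ X, ∑ w ∈ Yᶜ, g x' x * g x w * g w x' with hσ
  have hσ0 : ∀ x, 0 ≤ σ x := fun x => sum_nonneg fun x' _ => sum_nonneg fun w _ =>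
    mul_nonneg (mul_nonneg (h.nonneg _ _) (h.nonneg _ _)) (h.nonneg _ _)
  set T := X.filter fun x => σ x ≤ τ * N ^ 2 with hT
  have hTX : T ⊆ X := filter_subset _ _
  have hcard : ((X \ T).card : ℝ) ≤ τ * N := by
    have h1 : ((X \ T).card : ℝ) * (τ * N ^ 2) ≤ ∑ x ∈ X \ T, σ x := by
      rw [← nsmul_eq_mul]
      refine card_nsmul_le_sum _ _ _ fun x hx => ?_
      simp only [hT, mem_sdiff, mem_filter, not_and, not_le] at hx
      exact (hx.2 hx.1).le
    have h2 : ∑ x ∈ X \ T, σ x ≤ ∑ x ∈ X, σ x :=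
      sum_le_sum_of_subset_of_nonneg sdiff_subset fun x _ _ => hσ0 x
    have h3 : ((X \ T).card : ℝ) * (τ * N ^ 2) ≤ (τ * N) * (τ * N ^ 2) := by
      calc _ ≤ _ := h1.trans (h2.trans hcyc)
        _ = _ := by ring
    exact le_of_mul_le_mul_right h3 (by positivity)
  refine ⟨T, hTX, hcard, ?_⟩
  set D : V → ℝ := fun x => ∑ w ∈ Y, g x w with hD
  set R : V → ℝ := fun x => ∑ w ∈ X, g w x with hR
  have hD0 : ∀ x, 0 ≤ D x := fun x => sum_nonneg fun w _ => h.nonneg _ _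
  have hR0 : ∀ x, 0 ≤ R x := fun x => sum_nonneg fun w _ => h.nonneg _ _
  have hDN : ∀ x, D x ≤ N := fun x =>
    (h.sum_le_card x Y).trans (Nat.cast_le.2 Y.card_le_univ)
  have hRN : ∀ x, R x ≤ N := fun x =>
    (h.transpose.sum_le_card x X).trans (Nat.cast_le.2 X.card_le_univ)
  intro x hx
  obtain ⟨a, haT, hmin⟩ := exists_min_image T (fun x => D x - 3 / 4 * R x) ⟨x, hx⟩
  have hXY' : X ⊆ Yᶜ := fun v hv => mem_compl.2 (disjoint_left.1 hXY hv)
  have upper : ∑ y ∈ X, g y a * ((D a - 3 / 4 * R a) - (D y - 3 / 4 * R y)) ≤ 2 * τ * N ^ 2 := by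
    rw [← sum_sdiff hTX]
    have h1 : ∑ y ∈ X \ T, g y a * ((D a - 3 / 4 * R a) - (D y - 3 / 4 * R y))
        ≤ (X \ T).card • (2 * N) := by
      refine sum_le_card_nsmul _ _ _ fun y _ => ?_
      have : (D a - 3 / 4 * R a) - (D y - 3 / 4 * R y) ≤ 2 * N := by
        linarith [hDN a, hR0 a, hD0 y, hRN y]
      calc _ ≤ g y a * (2 * N) := mul_le_mul_of_nonneg_left this (h.nonneg _ _)
        _ ≤ 1 * (2 * N) := by gcongr; exact h.le_one _ _
        _ = _ := one_mul _
    have h2 : ∑ y ∈ T, g y a * ((D a - 3 / 4 * R a) - (D y - 3 / 4 * R y)) ≤ 0 :=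
      sum_nonpos fun y hy => mul_nonpos_of_nonneg_of_nonpos (h.nonneg _ _) (by
        linarith [hmin y hy])
    rw [nsmul_eq_mul] at h1
    nlinarith
  have lower : ∑ y ∈ X, g y a * (1 / 4 * R a - 1 / 4 * R y - 6 * c * N) - σ a ≤
      ∑ y ∈ X, g y a * ((D a - 3 / 4 * R a) - (D y - 3 / 4 * R y)) := by
    have e : σ a = ∑ y ∈ X, g y a * ∑ w ∈ Yᶜ, g a w * g w y := by
      simp only [hσ, mul_sum, mul_assoc]
    rw [e, ← sum_sub_distrib]
    refine sum_le_sum fun y _ => ?_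
    rw [← mul_sub]
    refine mul_le_mul_of_nonneg_left ?_ (h.nonneg _ _)
    have h1 := h.outdeg_sub_ge y a Y
    have h2 := h.indeg_sub_le y a X
    have h3 : ∑ w ∈ X, g y w * g w a ≤ ∑ w ∈ Yᶜ, g y w * g w a :=
      sum_le_sum_of_subset_of_nonneg hXY' fun w _ _ => mul_nonneg (h.nonneg _ _) (h.nonneg _ _)
    simp only [hD, hR]
    linarith
  have hexp : ∑ y ∈ X, g y a * (1 / 4 * R a - 1 / 4 * R y - 6 * c * N) =
      1 / 4 * R a ^ 2 - 1 / 4 * ∑ y ∈ X, g y a * R y - 6 * c * N * R a := by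
    have : ∀ y, g y a * (1 / 4 * R a - 1 / 4 * R y - 6 * c * N) =
      (1 / 4 * R a - 6 * c * N) * g y a - 1 / 4 * (g y a * R y) := fun y => by ring
    simp only [this, sum_sub_distrib, ← mul_sum]
    change (1 / 4 * R a - 6 * c * N) * R a - _ = _
    ring
  have hpaths := h.sum_indeg_le a X
  have hσ' : ∑ x ∈ X, ∑ w ∈ X, g x a * g a w * g w x ≤ σ a :=
    sum_le_sum fun y _ => sum_le_sum_of_subset_of_nonneg hXY' fun w _ _ =>
      mul_nonneg (mul_nonneg (h.nonneg _ _) (h.nonneg _ _)) (h.nonneg _ _)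
  have hσa : σ a ≤ τ * N ^ 2 := (mem_filter.1 haT).2
  change ∑ y ∈ X, g y a * R y ≤ R a ^ 2 / 2 + _ + 2 * c * N * R a at hpaths
  have hcNR : c * N * R a ≤ τ * N * N := by
    have := hRN a; have := hR0 a; gcongr
  have hsq : R a ^ 2 ≤ (δ * N) ^ 2 := by
    rw [mul_pow, hδτ]
    nlinarith [sq_nonneg N]
  have hRa : R a ≤ δ * N := le_of_sq_le_sq hsq (by positivity)
  have := hmin x hx
  change 3 / 4 * R x ≤ D x + δ * N
  linarith [hD0 a, hR0 a]

/-- If few cyclic triangles have an edge inside `X` and the third vertex outside `Y`, then the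
number of two-edge paths with both ends in `X` and the middle vertex in `Z` is at most about
`|Y||X|²/4`, for every `Z` disjoint from `Y`. -/
theorem sum_paths_le [DecidableEq V] (h : IsNearRegular g c) (hc : 0 ≤ c) {X Y Z : Finset V}
    (hYZ : Disjoint Z Y) {ε : ℝ}
    (hcyc : ∑ x ∈ X, ∑ x' ∈ X, ∑ w ∈ Yᶜ, g x' x * g x w * g w x'
      ≤ ε * (Fintype.card V : ℝ) ^ 3) :
    ∑ w ∈ Z, (∑ x ∈ X, g w x) * ∑ x ∈ X, g x w ≤
      (Y.card : ℝ) * (X.card : ℝ) ^ 2 / 4 + (2 * ε + 6 * c) * (Fintype.card V : ℝ) ^ 3 := by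
  set N : ℝ := (Fintype.card V : ℝ)
  have hXN : (X.card : ℝ) ≤ N := Nat.cast_le.2 X.card_le_univ
  have hZN : (Z.card : ℝ) ≤ N := Nat.cast_le.2 Z.card_le_univ
  have hN0 : 0 ≤ N := Nat.cast_nonneg _
  have hZY : Z ⊆ Yᶜ := fun v hv => mem_compl.2 (disjoint_left.1 hYZ hv)
  have upper : ∑ x ∈ X, ∑ y ∈ X, g x y * (∑ w ∈ Y, g y w - ∑ w ∈ Y, g x w) ≤
      (Y.card : ℝ) * (X.card : ℝ) ^ 2 / 4 := by
    have e : ∑ x ∈ X, ∑ y ∈ X, g x y * (∑ w ∈ Y, g y w - ∑ w ∈ Y, g x w) =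
        ∑ w ∈ Y, ∑ x ∈ X, ∑ y ∈ X, g x y * (g y w - g x w) := by
      rw [sum_comm]
      simp only [← sum_sub_distrib, mul_sum]
      rw [sum_comm]
      rw [sum_comm (s := Y)]
      exact sum_congr rfl fun x _ => sum_comm
    rw [e]
    have : ∀ w ∈ Y, ∑ x ∈ X, ∑ y ∈ X, g x y * (g y w - g x w) ≤ (X.card : ℝ) ^ 2 / 4 := by
      intro w _
      have h1 : ∑ x ∈ X, ∑ y ∈ X, g x y * (g y w - g x w) ≤
          ∑ x ∈ X, ∑ y ∈ X, (1 - g x w) * g y w := by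
        refine sum_le_sum fun x _ => sum_le_sum fun y _ => ?_
        rcases h.zero_or_one x y with e1 | e1 <;> rcases h.zero_or_one y w with e2 | e2 <;>
        rcases h.zero_or_one x w with e3 | e3 <;> rw [e1, e2, e3] <;> norm_num
      rw [← sum_mul_sum] at h1
      simp only [sum_sub_distrib, sum_const, nsmul_eq_mul, mul_one] at h1
      nlinarith [sq_nonneg ((X.card : ℝ) - 2 * ∑ y ∈ X, g y w)]
    have := sum_le_card_nsmul _ _ _ this
    rw [nsmul_eq_mul] at this
    linarith
  have lower : ∑ x ∈ X, ∑ y ∈ X, (∑ w ∈ Z, g x y * (g x w * g w y)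
      - ∑ w ∈ Yᶜ, g x y * g y w * g w x - 4 * c * N) ≤
      ∑ x ∈ X, ∑ y ∈ X, g x y * (∑ w ∈ Y, g y w - ∑ w ∈ Y, g x w) := by
    refine sum_le_sum fun x _ => sum_le_sum fun y _ => ?_
    have h1 := h.outdeg_sub_ge x y Y
    have h3 : ∑ w ∈ Z, g x w * g w y ≤ ∑ w ∈ Yᶜ, g x w * g w y :=
      sum_le_sum_of_subset_of_nonneg hZY fun w _ _ => mul_nonneg (h.nonneg _ _) (h.nonneg _ _)
    simp only [mul_assoc (g x y), ← mul_sum]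
    rcases h.zero_or_one x y with e | e <;> rw [e]
    · have : 0 ≤ c * N := mul_nonneg hc hN0
      linarith
    · linarith
  simp only [sum_sub_distrib] at lower
  have e1 : ∑ x ∈ X, ∑ y ∈ X, ∑ w ∈ Yᶜ, g x y * g y w * g w x ≤ ε * N ^ 3 := by
    rw [sum_comm]; exact hcyc
  have e2 : ∑ x ∈ X, ∑ y ∈ X, 4 * c * N ≤ 4 * c * N ^ 3 := by
    simp only [sum_const, nsmul_eq_mul]
    have : (X.card : ℝ) * (X.card * (4 * c * N)) ≤ N * (N * (4 * c * N)) := by gcongr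
    linarith
  have paths : ∑ w ∈ Z, (∑ x ∈ X, g w x) * ∑ x ∈ X, g x w ≤
      ∑ x ∈ X, ∑ y ∈ X, ∑ w ∈ Z, g x y * (g x w * g w y)
      + ∑ x ∈ X, ∑ y ∈ X, ∑ w ∈ Z, g y x * g x w * g w y
      + ∑ x ∈ X, ∑ y ∈ X, ∑ _w ∈ Z, (1 - g x y - g y x) := by
    have e : ∑ w ∈ Z, (∑ x ∈ X, g w x) * ∑ x ∈ X, g x w =
        ∑ x ∈ X, ∑ y ∈ X, ∑ w ∈ Z, g x w * g w y := by
      rw [sum_congr rfl fun x _ => sum_comm (s := X) (t := Z), sum_comm]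
      refine sum_congr rfl fun w _ => ?_
      rw [mul_comm, sum_mul_sum]
    rw [e]
    simp only [← sum_add_distrib]
    refine sum_le_sum fun x _ => sum_le_sum fun y _ => sum_le_sum fun w _ => ?_
    have a1 := h.add_le_one x y
    rcases h.zero_or_one x y with e1 | e1 <;> rcases h.zero_or_one y x with e2 | e2 <;>
    rcases h.zero_or_one x w with e3 | e3 <;> rcases h.zero_or_one w y with e4 | e4 <;>
    rw [e1, e2] at a1 <;> rw [e1, e2, e3, e4] <;> linarith
  have e3 : ∑ x ∈ X, ∑ y ∈ X, ∑ w ∈ Z, g y x * g x w * g w y ≤ ε * N ^ 3 :=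
    le_trans (sum_le_sum fun x _ => sum_le_sum fun y _ =>
      sum_le_sum_of_subset_of_nonneg hZY fun w _ _ =>
        mul_nonneg (mul_nonneg (h.nonneg _ _) (h.nonneg _ _)) (h.nonneg _ _)) hcyc
  have e4 : ∑ x ∈ X, ∑ y ∈ X, ∑ _w ∈ Z, (1 - g x y - g y x) ≤ 2 * c * N ^ 3 := by
    have : ∀ x ∈ X, ∑ y ∈ X, ∑ _w ∈ Z, (1 - g x y - g y x) ≤ N * (2 * c * N) := by
      intro x _
      simp only [sum_const, nsmul_eq_mul, ← mul_sum]
      have := h.sum_nonadj_le x X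
      have h0 : 0 ≤ ∑ v ∈ X, (1 - g x v - g v x) :=
        sum_nonneg fun v _ => by linarith [h.add_le_one x v]
      gcongr
    have := sum_le_card_nsmul _ _ _ this
    rw [nsmul_eq_mul] at this
    have h2 : (X.card : ℝ) * (N * (2 * c * N)) ≤ N * (N * (2 * c * N)) := by gcongr
    linarith
  linarith

/-- If few cyclic triangles have an edge inside `A` and the third vertex outside `B`, then there
are almost `9/16` as many two-edge paths in `B A B` as in `A A A`. -/
theorem sum_paths_transfer [DecidableEq V] (h : IsNearRegular g c) (hN : 0 < Fintype.card V)
    {A B : Finset V} (hAB : Disjoint A B) {τ δ : ℝ} (hcτ : c ≤ τ) (hτ : 0 < τ)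
    (hδ : 0 < δ) (hδ1 : δ ≤ 1) (hδτ : δ ^ 2 = 80 * τ)
    (hcyc : ∑ x ∈ A, ∑ x' ∈ A, ∑ w ∈ Bᶜ, g x' x * g x w * g w x'
      ≤ τ ^ 2 * (Fintype.card V : ℝ) ^ 3) :
    9 / 16 * ∑ x ∈ A, (∑ w ∈ A, g x w) * ∑ w ∈ A, g w x ≤
      ∑ x ∈ A, (∑ w ∈ B, g x w) * ∑ w ∈ B, g w x
        + (3 * δ + 2 * τ) * (Fintype.card V : ℝ) ^ 3 := by
  obtain ⟨T, hT, hTc, hTd⟩ := h.exists_typical hN hAB hcτ hτ hδ.le hδτ hcyc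
  obtain ⟨T', hT', hTc', hTd'⟩ := h.transpose.exists_typical hN hAB hcτ hτ hδ.le hδτ (by
    rw [sum_comm]
    refine le_trans (le_of_eq ?_) hcyc
    exact sum_congr rfl fun x _ => sum_congr rfl fun y _ => sum_congr rfl fun w _ => by ring)
  set N : ℝ := (Fintype.card V : ℝ)
  have hN' : 0 < N := Nat.cast_pos.2 hN
  have hAN : (A.card : ℝ) ≤ N := Nat.cast_le.2 A.card_le_univ
  rw [mul_sum]
  have pt : ∀ x ∈ A, 9 / 16 * ((∑ w ∈ A, g x w) * ∑ w ∈ A, g w x) ≤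
      (∑ w ∈ B, g x w) * ∑ w ∈ B, g w x + 3 * δ * N ^ 2
        + (if x ∈ A \ T then N ^ 2 else 0) + (if x ∈ A \ T' then N ^ 2 else 0) := by
    intro x hx
    have d1 : 0 ≤ ∑ w ∈ B, g x w := sum_nonneg fun w _ => h.nonneg _ _
    have d2 : 0 ≤ ∑ w ∈ B, g w x := sum_nonneg fun w _ => h.nonneg _ _
    have r1 : 0 ≤ ∑ w ∈ A, g x w := sum_nonneg fun w _ => h.nonneg _ _
    have r2 : 0 ≤ ∑ w ∈ A, g w x := sum_nonneg fun w _ => h.nonneg _ _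
    have d1' : ∑ w ∈ B, g x w ≤ N :=
      (h.sum_le_card x B).trans (Nat.cast_le.2 B.card_le_univ)
    have d2' : ∑ w ∈ B, g w x ≤ N :=
      (h.transpose.sum_le_card x B).trans (Nat.cast_le.2 B.card_le_univ)
    have r1' : ∑ w ∈ A, g x w ≤ N := (h.sum_le_card x A).trans hAN
    have r2' : ∑ w ∈ A, g w x ≤ N := (h.transpose.sum_le_card x A).trans hAN
    have trivial_bound : 9 / 16 * ((∑ w ∈ A, g x w) * ∑ w ∈ A, g w x) ≤ N ^ 2 := by
      have := mul_le_mul r1' r2' r2 hN'.le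
      nlinarith [mul_nonneg r1 r2]
    have d12 := mul_nonneg d1 d2
    have hδN : 0 ≤ 3 * δ * N ^ 2 := by positivity
    have hN2 : 0 ≤ N ^ 2 := by positivity
    by_cases hxT : x ∈ T
    · by_cases hxT' : x ∈ T'
      · simp only [mem_sdiff, hxT, hxT', not_true, and_false, if_false, add_zero]
        have t1 := hTd x hxT
        have t2 := hTd' x hxT'
        have := mul_le_mul t1 t2 (by positivity) (by positivity)
        have k1 : δ * N * ∑ w ∈ B, g x w ≤ δ * N * N := by gcongr
        have k2 : δ * N * ∑ w ∈ B, g w x ≤ δ * N * N := by gcongr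
        have k3 : δ * N * (δ * N) ≤ δ * N * N := by
          gcongr; nlinarith
        nlinarith
      · simp only [mem_sdiff, hx, hxT', not_false_iff, and_self, if_true]
        split_ifs <;> linarith
    · simp only [mem_sdiff, hx, hxT, not_false_iff, and_self, if_true]
      split_ifs <;> linarith
  have := sum_le_sum pt
  simp only [sum_add_distrib, sum_const, nsmul_eq_mul, sum_ite_mem,
    inter_eq_right.2 sdiff_subset] at this
  have b1 : (A.card : ℝ) * (3 * δ * N ^ 2) ≤ N * (3 * δ * N ^ 2) := by gcongr
  have b2 : ((A \ T).card : ℝ) * N ^ 2 ≤ τ * N * N ^ 2 := by gcongr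
  have b3 : ((A \ T').card : ℝ) * N ^ 2 ≤ τ * N * N ^ 2 := by gcongr
  linarith

/-- There are no disjoint `A`, `B`, `C` with `A` the largest such that almost all cyclic triangles
with an edge inside `A` have their third vertex in `B`, and almost all cyclic triangles with an
edge inside `B` have their third vertex in `C`. -/
theorem no_three_chain [DecidableEq V] (h : IsNearRegular g c) (hN : 0 < Fintype.card V)
    {A B C : Finset V} (hAB : Disjoint A B) (hBC : Disjoint B C) (hAC : Disjoint A C)
    {η τ δ : ℝ} (hη : 0 < η) (hη1 : η < 1) (hδη : δ = η ^ 3 / 400) (hδτ : δ ^ 2 = 80 * τ)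
    (hc : 0 ≤ c) (hcτ : c ≤ τ)
    (hA : η * Fintype.card V ≤ A.card) (hBA : B.card ≤ A.card) (hCA : C.card ≤ A.card)
    (hcycA : ∑ x ∈ A, ∑ x' ∈ A, ∑ w ∈ Bᶜ, g x' x * g x w * g w x'
      ≤ τ ^ 2 * (Fintype.card V : ℝ) ^ 3)
    (hcycB : ∑ x ∈ B, ∑ x' ∈ B, ∑ w ∈ Cᶜ, g x' x * g x w * g w x'
      ≤ τ ^ 2 * (Fintype.card V : ℝ) ^ 3) : False := by
  have hδ : 0 < δ := by rw [hδη]; positivity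
  have hδ1 : δ < 1 / 400 := by
    rw [hδη]; have := pow_lt_one₀ hη.le hη1 (n := 3) (by norm_num); linarith
  have hτ : 0 < τ := by linarith [pow_pos hδ 2]
  have hcmp := h.sum_paths_transfer hN hAB hcτ hτ hδ (by linarith) hδτ hcycA
  have hsum := h.sum_paths_le hc (Z := A ∪ B) (disjoint_union_left.2 ⟨hAC, hBC⟩) hcycB
  rw [sum_union hAB] at hsum
  have hPA := h.sum_paths_ge hc A
  have hPB := h.sum_paths_ge hc B
  have hBA' : (B.card : ℝ) ≤ A.card := Nat.cast_le.2 hBA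
  have hCA' : (C.card : ℝ) ≤ A.card := Nat.cast_le.2 hCA
  have hb : (0 : ℝ) ≤ B.card := Nat.cast_nonneg _
  have hN' : (0 : ℝ) < Fintype.card V := Nat.cast_pos.2 hN
  generalize (Fintype.card V : ℝ) = N at *
  generalize (A.card : ℝ) = a at *
  generalize (B.card : ℝ) = b at *
  generalize (C.card : ℝ) = s at *
  have hsb : s * b ^ 2 ≤ a * b ^ 2 := by gcongr
  have hid : 0 ≤ a ^ 3 - 3 * (a * b ^ 2) + 2 * b ^ 3 := by
    have : 0 ≤ (a - b) ^ 2 * (a + 2 * b) := mul_nonneg (sq_nonneg _) (by linarith)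
    linarith
  have ha3 : (η * N) ^ 3 ≤ a ^ 3 := by gcongr
  have hη3 : (η * N) ^ 3 = 400 * (δ * N ^ 3) := by rw [hδη]; ring
  have hsmall : 2 * τ ^ 2 + 8 * c + 3 * δ + 2 * τ ≤ 4 * δ := by
    have h1 : δ * δ ≤ δ * (1 / 400) := by gcongr
    have h2 : τ ≤ 1 := by linarith
    have h3 : τ * τ ≤ τ * 1 := by gcongr
    linarith
  have hfin : (2 * τ ^ 2 + 8 * c + 3 * δ + 2 * τ) * N ^ 3 ≤ 4 * δ * N ^ 3 := by gcongr
  have hpos : 0 < δ * N ^ 3 := by positivity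
  have hcN : 0 ≤ c * N ^ 3 := by positivity
  linarith

end IsNearRegular

/-- The vertex sets of cyclic triangles with index vector `v` with respect to `P`. -/
noncomputable def cycTrisOfIndex {n d : ℕ} (G : Fin n → Fin n → Prop) (P : Fin d → Finset (Fin n))
    (v : Fin d → ℤ) : Finset (Finset (Fin n)) :=
  ((univ : Finset (Fin n)).powersetCard 3).filter fun e =>
    IsCycTri G e ∧ (fun i => ((e ∩ P i).card : ℤ)) = v

theorem isNearRegular_of_minSemidegreeGE {n : ℕ} {G : Fin n → Fin n → Prop} (hG : IsOriented G)
    {c : ℝ} (hdeg : MinSemidegreeGE G ((1 / 2 - c) * n)) :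
    IsNearRegular (fun u v => if G u v then (1 : ℝ) else 0) c where
  zero_or_one u v := by by_cases h : G u v <;> simp [h]
  add_le_one u v := by
    by_cases h : G u v
    · simp [h, hG.2 u v h]
    · simp only [h, if_false, zero_add]
      split_ifs <;> norm_num
  le_out u := by simpa [outDeg, outDegOn] using (hdeg u).1
  le_in u := by simpa [inDeg, inDegOn] using (hdeg u).2

theorem index_of_two_one {n d : ℕ} {P : Fin d → Finset (Fin n)}
    (hP : ∀ i j : Fin d, i ≠ j → Disjoint (P i) (P j)) {i k : Fin d} {x y z : Fin n}
    (hxy : x ≠ y) (hxz : x ≠ z) (hyz : y ≠ z) (hx : x ∈ P i) (hy : y ∈ P i) (hz : z ∈ P k) :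
    (fun l => ((({x, y, z} : Finset (Fin n)) ∩ P l).card : ℤ)) =
      Pi.single i (2 : ℤ) + Pi.single k 1 := by
  have hmem : ∀ {v : Fin n} {a l : Fin d}, v ∈ P a → (v ∈ P l ↔ l = a) := by
    intro v a l hv
    refine ⟨fun h => ?_, fun h => h ▸ hv⟩
    by_contra hne
    exact disjoint_left.1 (hP l a hne) h hv
  funext l
  rw [← filter_mem_eq_inter, card_filter, sum_insert (by simp [hxy, hxz]),
    sum_insert (by simpa using hyz), sum_singleton]
  simp only [hmem hx, hmem hy, hmem hz, Pi.add_apply, Pi.single_apply]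
  push_cast
  split_ifs <;> norm_num

theorem sum_cyc_le_card {n d : ℕ} {G : Fin n → Fin n → Prop} (hG : IsOriented G)
    {P : Fin d → Finset (Fin n)} (hP : ∀ i j : Fin d, i ≠ j → Disjoint (P i) (P j))
    (i k : Fin d) :
    ∑ x ∈ P i, ∑ y ∈ P i, ∑ w ∈ P k,
      (if G y x then (1 : ℝ) else 0) * (if G x w then 1 else 0) * (if G w y then 1 else 0)
      ≤ 27 * ((cycTrisOfIndex G P (Pi.single i 2 + Pi.single k 1)).card : ℝ) := by
  set E := cycTrisOfIndex G P (Pi.single i 2 + Pi.single k 1)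
  set S := (P i ×ˢ P i ×ˢ P k).filter fun t => G t.2.1 t.1 ∧ G t.1 t.2.2 ∧ G t.2.2 t.2.1 with hS
  have hsum : ∑ x ∈ P i, ∑ y ∈ P i, ∑ w ∈ P k,
      (if G y x then (1 : ℝ) else 0) * (if G x w then 1 else 0) * (if G w y then 1 else 0)
      = S.card := by
    rw [hS, card_filter]
    push_cast
    rw [sum_product]
    refine sum_congr rfl fun x _ => ?_
    rw [sum_product]
    refine sum_congr rfl fun y _ => sum_congr rfl fun w _ => ?_
    by_cases h1 : G y x <;> by_cases h2 : G x w <;> by_cases h3 : G w y <;> simp [h1, h2, h3]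
  have hSE : S ⊆ E.biUnion fun e => e ×ˢ e ×ˢ e := by
    rintro ⟨x, y, w⟩ ht
    simp only [hS, mem_filter, mem_product] at ht
    obtain ⟨⟨hx, hy, hw⟩, g1, g2, g3⟩ := ht
    have hne : ∀ {u v}, G u v → u ≠ v := fun {u v} h e => hG.1 v (e ▸ h)
    refine mem_biUnion.2 ⟨{x, y, w}, ?_, by simp⟩
    refine mem_filter.2 ⟨mem_powersetCard.2 ⟨subset_univ _, ?_⟩, ⟨x, w, y, g2, g3, g1, ?_⟩, ?_⟩
    · exact card_eq_three.2 ⟨x, y, w, (hne g1).symm, hne g2, (hne g3).symm, rfl⟩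
    · rw [pair_comm]
    · exact index_of_two_one hP (hne g1).symm (hne g2) (hne g3).symm hx hy hw
  have hcard : S.card ≤ E.card * 27 := by
    refine (card_le_card hSE).trans (card_biUnion_le_card_mul _ _ _ fun e he => ?_)
    have : e.card = 3 := (mem_powersetCard.1 (mem_filter.1 he).1).2
    simp [card_product, this]
  rw [hsum]
  have : (S.card : ℝ) ≤ E.card * 27 := by exact_mod_cast hcard
  linarith

theorem cyc3_le_sum {n d : ℕ} (G : Fin n → Fin n → Prop) {P : Fin d → Finset (Fin n)}
    (hP : ∀ i j : Fin d, i ≠ j → Disjoint (P i) (P j)) (hcov : univ.biUnion P = univ)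
    (i : Fin d) :
    cyc3 G (P i) (P i) (P i)ᶜ ≤
      ∑ k ∈ univ.erase i, (cycTrisOfIndex G P (Pi.single i 2 + Pi.single k 1)).card := by
  refine le_trans (card_le_card ?_) card_biUnion_le
  intro s hs
  obtain ⟨hs3, hcyc, x, hx, y, hy, z, hz, rfl⟩ := mem_filter.1 hs
  obtain ⟨k, -, hk⟩ := mem_biUnion.1 (hcov ▸ mem_univ z)
  have hki : k ≠ i := by rintro rfl; exact mem_compl.1 hz hk
  have hc3 := (mem_powersetCard.1 hs3).2
  have hxz : x ≠ z := by rintro rfl; exact mem_compl.1 hz hx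
  have hyz : y ≠ z := by rintro rfl; exact mem_compl.1 hz hy
  have hxy : x ≠ y := by
    rintro rfl
    rw [insert_eq_of_mem (mem_insert_self _ _)] at hc3
    have := card_le_two (a := x) (b := z)
    omega
  exact mem_biUnion.2 ⟨k, mem_erase.2 ⟨hki, mem_univ _⟩,
    mem_filter.2 ⟨hs3, hcyc, index_of_two_one hP hxy hxz hyz hx hy hk⟩⟩

theorem card_parts_mul_le {n d : ℕ} (hn : 0 < n) {P : Fin d → Finset (Fin n)}
    (hP : ∀ i j : Fin d, i ≠ j → Disjoint (P i) (P j)) {η : ℝ}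
    (hη : ∀ i, η * n ≤ ((P i).card : ℝ)) : d * η ≤ 1 := by
  have hn' : (0 : ℝ) < n := Nat.cast_pos.2 hn
  have h1 : ∑ i, (P i).card ≤ n := by
    rw [← card_biUnion fun i _ j _ h => hP i j h]
    simpa using card_le_univ (univ.biUnion P)
  have h2 : ∑ _i : Fin d, η * n ≤ ∑ i, ((P i).card : ℝ) := sum_le_sum fun i _ => hη i
  have h3 : ∑ i, ((P i).card : ℝ) ≤ n := by exact_mod_cast h1
  simp only [sum_const, card_univ, Fintype.card_fin, nsmul_eq_mul] at h2
  refine le_of_mul_le_mul_right ?_ hn'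
  linarith

theorem stmt_19 :
    ∀ η : ℝ, 0 < η → η < 1 →
    ∃ α₀ > (0:ℝ), ∀ α : ℝ, 0 < α → α ≤ α₀ →
    ∃ μ₀ > (0:ℝ), ∀ μ : ℝ, 0 < μ → μ ≤ μ₀ →
    ∃ c₀ > (0:ℝ), ∀ c : ℝ, 0 < c → c ≤ c₀ →
    ∃ N : ℕ, ∀ n : ℕ, N ≤ n → ∀ G : Fin n → Fin n → Prop, IsOriented G →
      MinSemidegreeGE G ((1/2 - c) * n) →
      ∀ d : ℕ, 2 ≤ d → ∀ P : Fin d → Finset (Fin n),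
        (∀ i j : Fin d, i ≠ j → Disjoint (P i) (P j)) →
        ((univ : Finset (Fin d)).biUnion P = univ) →
        (∀ i : Fin d, η * n ≤ ((P i).card : ℝ)) →
        (∀ i j : Fin d, i ≠ j →
          Pi.single i (1:ℤ) - Pi.single j (1:ℤ) ∉
            AddSubgroup.closure {v : Fin d → ℤ |
              μ * (n : ℝ)^3 ≤ ((((univ : Finset (Fin n)).powersetCard 3).filter fun e =>
                IsCycTri G e ∧ (fun i => ((e ∩ P i).card : ℤ)) = v).card : ℝ)}) →
        ∃ i : Fin d, (cyc3 G (P i) (P i) (P i)ᶜ : ℝ) ≤ α * n^3 := by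
 
  intro η hη hη1
  obtain ⟨δ, hδη⟩ : ∃ δ : ℝ, δ = η ^ 3 / 400 := ⟨_, rfl⟩
  obtain ⟨τ, hτδ⟩ : ∃ τ : ℝ, τ = δ ^ 2 / 80 := ⟨_, rfl⟩
  have hδ : 0 < δ := by rw [hδη]; positivity
  have hτ : 0 < τ := by rw [hτδ]; positivity
  refine ⟨1, one_pos, fun α hα _ => ⟨min (α * η) (τ ^ 2 * η / 27), by positivity,
    fun μ hμ hμ₀ => ⟨τ, hτ, fun c hc hcτ => ⟨1, ?_⟩⟩⟩⟩
  intro n hn G hG hdeg d hd P hP hcov hsize hfree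
  have hμα : μ ≤ α * η := hμ₀.trans (min_le_left _ _)
  have hμτ : 27 * μ ≤ τ ^ 2 * η := by linarith [hμ₀.trans (min_le_right _ _)]
  have hdη : d * η ≤ 1 := card_parts_mul_le hn hP hsize
  by_contra! hmany
  let Robust : (Fin d → ℤ) → Prop :=
    fun v => μ * (n : ℝ) ^ 3 ≤ ((cycTrisOfIndex G P v).card : ℝ)
  have hdiff : ∀ {v w : Fin d → ℤ}, Robust v → Robust w →
      ∀ i j : Fin d, i ≠ j → v - w ≠ Pi.single i 1 - Pi.single j 1 := by
    intro v w hv hw i j hij h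
    refine hfree i j hij (h ▸ AddSubgroup.sub_mem _ ?_ ?_)
    · exact AddSubgroup.subset_closure hv
    · exact AddSubgroup.subset_closure hw
  have hunique : ∀ i j k : Fin d, Robust (Pi.single i 2 + Pi.single j 1) →
      Robust (Pi.single i 2 + Pi.single k 1) → k = j := by
    intro i j k hj hk
    by_contra hne
    exact hdiff hk hj k j hne (add_sub_add_left_eq_sub _ _ _)
  have hexists : ∀ i : Fin d, ∃ j, j ≠ i ∧ Robust (Pi.single i 2 + Pi.single j 1) := by
    intro i
    by_contra! hnone
    have h1 : (cyc3 G (P i) (P i) (P i)ᶜ : ℝ) ≤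
        ∑ k ∈ univ.erase i, ((cycTrisOfIndex G P (Pi.single i 2 + Pi.single k 1)).card : ℝ) := by
      exact_mod_cast cyc3_le_sum G hP hcov i
    have h2 : ∑ k ∈ univ.erase i,
        ((cycTrisOfIndex G P (Pi.single i 2 + Pi.single k 1)).card : ℝ) ≤
        ∑ _k : Fin d, μ * (n : ℝ) ^ 3 :=
      (sum_le_sum fun k hk => (not_le.1 (hnone k (ne_of_mem_erase hk))).le).trans
        (sum_le_sum_of_subset_of_nonneg (erase_subset _ _) fun _ _ _ => by positivity)
    simp only [sum_const, card_univ, Fintype.card_fin, nsmul_eq_mul] at h2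
    have h3 : (d : ℝ) * μ ≤ α := by
      calc (d : ℝ) * μ ≤ d * (α * η) := by gcongr
        _ = α * (d * η) := by ring
        _ ≤ α * 1 := by gcongr
        _ = α := mul_one α
    have h4 : (d : ℝ) * μ * (n : ℝ) ^ 3 ≤ α * (n : ℝ) ^ 3 := by gcongr
    linarith [hmany i]
  choose f hf hfR using hexists
  have hcyc : ∀ i, ∑ x ∈ P i, ∑ y ∈ P i, ∑ w ∈ (P (f i))ᶜ,
      (if G y x then (1 : ℝ) else 0) * (if G x w then 1 else 0) * (if G w y then 1 else 0)
      ≤ τ ^ 2 * (Fintype.card (Fin n) : ℝ) ^ 3 := by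
    intro i
    have hcompl : (P (f i))ᶜ = (univ.erase (f i)).biUnion P := by
      ext w
      obtain ⟨k, -, hk⟩ := mem_biUnion.1 (hcov ▸ mem_univ w)
      simp only [mem_compl, mem_biUnion, mem_erase, mem_univ, and_true]
      refine ⟨fun hw => ⟨k, fun e => hw (e ▸ hk), hk⟩, fun ⟨l, hl, hwl⟩ hw => ?_⟩
      exact disjoint_left.1 (hP l _ hl) hwl hw
    rw [hcompl]
    simp only [sum_biUnion fun a _ b _ h => hP a b h]
    rw [sum_congr rfl fun x _ => sum_comm, sum_comm]
    have h1 := sum_le_sum fun k (hk : k ∈ univ.erase (f i)) =>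
      (sum_cyc_le_card hG hP i k).trans
        (mul_le_mul_of_nonneg_left (not_le.1 fun h => ne_of_mem_erase hk
          (hunique i (f i) k (hfR i) h)).le (by norm_num))
    have h2 : ∑ _k ∈ univ.erase (f i), (27 : ℝ) * (μ * (n : ℝ) ^ 3) ≤
        ∑ _k : Fin d, 27 * (μ * (n : ℝ) ^ 3) :=
      sum_le_sum_of_subset_of_nonneg (erase_subset _ _) fun _ _ _ => by positivity
    refine h1.trans (h2.trans ?_)
    simp only [sum_const, card_univ, Fintype.card_fin, nsmul_eq_mul]
    have h3 : (d : ℝ) * (27 * μ) ≤ τ ^ 2 := by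
      calc (d : ℝ) * (27 * μ) ≤ d * (τ ^ 2 * η) := by gcongr
        _ = τ ^ 2 * (d * η) := by ring
        _ ≤ τ ^ 2 * 1 := by gcongr
        _ = τ ^ 2 := mul_one _
    have h4 : (d : ℝ) * (27 * μ) * (n : ℝ) ^ 3 ≤ τ ^ 2 * (n : ℝ) ^ 3 := by gcongr
    linarith
  obtain ⟨i, -, hmax⟩ := exists_max_image univ (fun i => (P i).card)
    ⟨(⟨0, by omega⟩ : Fin d), mem_univ _⟩
  have hcycle : f (f i) ≠ i := by
    intro h
    have h2 := hfR (f i)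
    rw [h] at h2
    refine hdiff (hfR i) h2 i (f i) (hf i).symm ?_
    funext l
    simp only [Pi.sub_apply, Pi.add_apply, Pi.single_apply]
    split_ifs <;> norm_num
  exact (isNearRegular_of_minSemidegreeGE hG hdeg).no_three_chain
    (by rw [Fintype.card_fin]; exact hn)
    (hP _ _ (hf i).symm) (hP _ _ (hf (f i)).symm) (hP _ _ hcycle.symm) hη hη1 hδη
    (by rw [hτδ]; ring) hc.le hcτ (by simpa using hsize i) (hmax _ (mem_univ _))
    (hmax _ (mem_univ _)) (hcyc i) (hcyc (f i))
end
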